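/- Theorem 5.3: Let m ∈ ℕ⁺ and suppose the cut-offs 𝒳 and 𝒴_ε are of class C^{m+3}. Then for any wave number k > 0 and any positive integer N, L_{dN} converges uniformly to L_d with m-th order accuracy; precisely, there is a constant C > 0, depending on ‖𝒳^{(m+3)}‖_{L¹[−c̃,c̃]}, on ‖𝒴_ε^{(n)}‖_{L¹} for 1 ≤ n ≤ m+3, on the lower bound b of |β_{n₁,n₂}|, and on k, but not on N, such that sup_{x ∈ D_{dc̃}, x₃ ≠ 0} | L_{dN}(x) − L_d(x) | ≤ C N^{−m}. -/

import Mathlib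

open MeasureTheory Complex Real

noncomputable section

/-- β_{n₁,n₂} from the eigenfunction expansion of the 3D doubly quasi-periodic
Green's function. -/
def betaCoef3 (k α₁ α₂ : ℝ) (n : ℤ × ℤ) : ℂ :=
  if (α₁ + (n.1 : ℝ)) ^ 2 + (α₂ + (n.2 : ℝ)) ^ 2 ≤ k ^ 2 then
    ((Real.sqrt (k ^ 2 - (α₁ + (n.1 : ℝ)) ^ 2 - (α₂ + (n.2 : ℝ)) ^ 2) : ℝ) : ℂ)
  else Complex.I * ((Real.sqrt ((α₁ + (n.1 : ℝ)) ^ 2 + (α₂ + (n.2 : ℝ)) ^ 2 - k ^ 2) : ℝ) : ℂ)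

/-- The doubly quasi-periodic Green's function (eigenfunction expansion). -/
def greenGd (k α₁ α₂ : ℝ) (x : EuclideanSpace ℝ (Fin 3)) : ℂ :=
  (Complex.I / (8 * (π : ℂ) ^ 2)) *
    ∑' n : ℤ × ℤ, (1 / betaCoef3 k α₁ α₂ n) *
      Complex.exp (Complex.I * ((α₁ + (n.1 : ℝ) : ℝ) : ℂ) * (x 0 : ℂ) +
        Complex.I * ((α₂ + (n.2 : ℝ) : ℝ) : ℂ) * (x 1 : ℂ) +
        Complex.I * betaCoef3 k α₁ α₂ n * ((|x 2| : ℝ) : ℂ))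

/-- K_d(x) = e^{−iα₁x₁−iα₂x₂} G_d(x) 𝒳(|x₃|). -/
def funKd (k α₁ α₂ : ℝ) (𝒳 : ℝ → ℝ) (x : EuclideanSpace ℝ (Fin 3)) : ℂ :=
  Complex.exp (-Complex.I * (α₁ : ℂ) * (x 0 : ℂ) - Complex.I * (α₂ : ℂ) * (x 1 : ℂ)) *
    greenGd k α₁ α₂ x * ((𝒳 |x 2| : ℝ) : ℂ)

/-- The box D_{dc̃} = [−π,π]² × [−c̃,c̃]. -/
def domDd (ct : ℝ) : Set (EuclideanSpace ℝ (Fin 3)) :=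
  {x | x 0 ∈ Set.Icc (-π) π ∧ x 1 ∈ Set.Icc (-π) π ∧ x 2 ∈ Set.Icc (-ct) ct}

/-- The Fourier basis φ_j(x) = (1/√(8π²c̃)) e^{i(j₁x₁ + j₂x₂ + j₃πx₃/c̃)}. -/
def fBasis3 (ct : ℝ) (j : ℤ × ℤ × ℤ) (x : EuclideanSpace ℝ (Fin 3)) : ℂ :=
  (1 / Real.sqrt (8 * π ^ 2 * ct) : ℝ) *
    Complex.exp (Complex.I * ((j.1 : ℂ) * (x 0 : ℂ) + (j.2.1 : ℂ) * (x 1 : ℂ) +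
      (j.2.2 : ℂ) * (π : ℂ) * (x 2 : ℂ) / (ct : ℂ)))

/-- The j-th Fourier coefficient ĝ_j = ∫_{D_{dc̃}} g(x) φ_{−j}(x) dx. -/
def fourierCoef3 (ct : ℝ) (g : EuclideanSpace ℝ (Fin 3) → ℂ) (j : ℤ × ℤ × ℤ) : ℂ :=
  ∫ x in domDd ct, g x * fBasis3 ct (-j) x

/-- F(x) = e^{−iα₁x₁−iα₂x₂} (e^{ik|x|}/(4π|x|)) 𝒴_ε(|x|). -/
def funF3 (k α₁ α₂ : ℝ) (𝒴 : ℝ → ℝ) (x : EuclideanSpace ℝ (Fin 3)) : ℂ :=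
  Complex.exp (-Complex.I * (α₁ : ℂ) * (x 0 : ℂ) - Complex.I * (α₂ : ℂ) * (x 1 : ℂ)) *
    (Complex.exp (Complex.I * (k : ℂ) * (‖x‖ : ℂ)) / (4 * (π : ℂ) * (‖x‖ : ℂ))) *
    ((𝒴 ‖x‖ : ℝ) : ℂ)

/-- L_d = K_d − F. -/
def funLd (k α₁ α₂ : ℝ) (𝒳 𝒴 : ℝ → ℝ) (x : EuclideanSpace ℝ (Fin 3)) : ℂ :=
  funKd k α₁ α₂ 𝒳 x - funF3 k α₁ α₂ 𝒴 x

/-- S_N = {j ∈ ℤ³ : −N ≤ j₁,j₂,j₃ < N}. -/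
def cubeIdx (N : ℕ) : Finset (ℤ × ℤ × ℤ) :=
  Finset.Icc (-(N : ℤ)) ((N : ℤ) - 1) ×ˢ
    (Finset.Icc (-(N : ℤ)) ((N : ℤ) - 1) ×ˢ Finset.Icc (-(N : ℤ)) ((N : ℤ) - 1))

/-- L_{dN} = Σ_{j∈S_N} L̂_{dj} φ_j. -/
def funLdN (k α₁ α₂ ct : ℝ) (𝒳 𝒴 : ℝ → ℝ) (N : ℕ) (x : EuclideanSpace ℝ (Fin 3)) : ℂ :=
  ∑ j ∈ cubeIdx N, fourierCoef3 ct (funLd k α₁ α₂ 𝒳 𝒴) j * fBasis3 ct j x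

/-- One integration by parts of an oscillatory integral without boundary terms. -/
theorem integral_mul_cexp_of_boundary_zero {f : ℝ → ℝ} (hf : ContDiff ℝ 1 f) {T : ℝ} {z : ℂ}
    (hz : z ≠ 0) (h0 : f 0 = 0) (hT : f T = 0) :
    ∫ t in (0 : ℝ)..T, (f t : ℂ) * Complex.exp (I * z * t) =
      (I / z) * ∫ t in (0 : ℝ)..T, ((deriv f t : ℝ) : ℂ) * Complex.exp (I * z * t) := by
  have hIz : I * z ≠ 0 := mul_ne_zero I_ne_zero hz
  have hv : ∀ t : ℝ, HasDerivAt (fun t : ℝ => Complex.exp (I * z * t) / (I * z))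
      (Complex.exp (I * z * t)) t := by
    intro t
    have h1 : HasDerivAt (fun t : ℝ => I * z * (t : ℂ)) (I * z) t := by
      simpa using (Complex.ofRealCLM.hasDerivAt (x := t)).const_mul (I * z)
    have h2 := (h1.cexp).div_const (I * z)
    rwa [mul_div_cancel_right₀ _ hIz] at h2
  have hu : ∀ t : ℝ, HasDerivAt (fun t : ℝ => (f t : ℂ)) ((deriv f t : ℝ) : ℂ) t := fun t =>
    ((hf.differentiable (by norm_num)) t).hasDerivAt.ofReal_comp
  have hdc : Continuous (deriv f) := hf.continuous_deriv (le_refl _)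
  rw [intervalIntegral.integral_mul_deriv_eq_deriv_mul (fun t _ => hu t) (fun t _ => hv t)
    ((by fun_prop : Continuous fun t : ℝ => ((deriv f t : ℝ) : ℂ)).intervalIntegrable _ _)
    ((by fun_prop : Continuous fun t : ℝ => Complex.exp (I * z * t)).intervalIntegrable _ _)]
  rw [h0, hT, ← intervalIntegral.integral_const_mul]
  simp only [ofReal_zero, zero_mul, sub_self, zero_sub]
  rw [← intervalIntegral.integral_neg]
  congr 1
  ext t
  field_simp
  rw [I_sq]
  ring

/-- Repeated integration by parts for a function vanishing on an open set containing both
endpoints. -/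
theorem integral_mul_cexp_eq_iteratedDeriv (p : ℕ) {f : ℝ → ℝ} (hf : ContDiff ℝ p f)
    {U : Set ℝ} (hU : IsOpen U) (hfU : ∀ t ∈ U, f t = 0) {T : ℝ} (h0 : (0 : ℝ) ∈ U) (hT : T ∈ U)
    {z : ℂ} (hz : z ≠ 0) :
    ∫ t in (0 : ℝ)..T, (f t : ℂ) * Complex.exp (I * z * t) =
      (I / z) ^ p * ∫ t in (0 : ℝ)..T, ((iteratedDeriv p f t : ℝ) : ℂ) * Complex.exp (I * z * t) := by
  induction p generalizing f with
  | zero => simp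
  | succ p ih =>
    have hd : ContDiff ℝ p (deriv f) := (contDiff_succ_iff_deriv.1 (by exact_mod_cast hf)).2.2
    have hdU : ∀ t ∈ U, deriv f t = 0 := fun t ht => by
      have : f =ᶠ[nhds t] fun _ => 0 := by
        filter_upwards [hU.mem_nhds ht] with s hs using hfU s hs
      rw [this.deriv_eq, deriv_const]
    rw [integral_mul_cexp_of_boundary_zero (hf.of_le (by norm_cast; omega)) hz (hfU _ h0)
      (hfU _ hT), ih hd hdU, iteratedDeriv_succ', pow_succ]
    ring

theorem iteratedDeriv_eq_zero_of_isOpen (p : ℕ) {f : ℝ → ℝ}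
    {U : Set ℝ} (hU : IsOpen U) (hfU : ∀ t ∈ U, f t = 0) : ∀ t ∈ U, iteratedDeriv p f t = 0 := by
  induction p generalizing f with
  | zero => simpa using hfU
  | succ p ih =>
    rw [iteratedDeriv_succ']
    refine ih fun t ht => ?_
    have : f =ᶠ[nhds t] fun _ => 0 := by
      filter_upwards [hU.mem_nhds ht] with s hs using hfU s hs
    rw [this.deriv_eq, deriv_const]

/-- The half-line Fourier integral of a cut-off function is `I / z` up to a remainder decaying
with the order of smoothness. -/
theorem exists_norm_integral_cutoff_sub_le (p : ℕ) {Z : ℝ → ℝ} (hZ : ContDiff ℝ (p + 1 : ℕ) Z)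
    {δ T' T : ℝ} (hδ : 0 < δ) (hδT : δ < T') (hT : T' < T) (h1 : ∀ t, |t| ≤ δ → Z t = 1)
    (h0 : ∀ t, T' ≤ t → Z t = 0) :
    ∃ B : ℝ, 0 ≤ B ∧ ∀ z : ℂ, z ≠ 0 → 0 ≤ z.im →
      ‖(∫ t in (0 : ℝ)..T, (Z t : ℂ) * Complex.exp (I * z * t)) - I / z‖ ≤
        B * Real.exp (-δ * z.im) / ‖z‖ ^ (p + 1) := by
  have hTpos : 0 < T := by linarith
  set U : Set ℝ := Set.Ioo (-δ) δ ∪ Set.Ioi T' with hUdef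
  have hU : IsOpen U := isOpen_Ioo.union isOpen_Ioi
  have h0U : (0 : ℝ) ∈ U := Or.inl ⟨by linarith, hδ⟩
  have hTU : T ∈ U := Or.inr hT
  have hd : ContDiff ℝ p (deriv Z) :=
    (contDiff_succ_iff_deriv.1 (by exact_mod_cast hZ)).2.2
  have hZ1 : ContDiff ℝ 1 Z := hZ.of_le (by norm_cast; omega)
  have hdU : ∀ t ∈ U, deriv Z t = 0 := by
    rintro t (ht | ht)
    · have : Z =ᶠ[nhds t] fun _ => 1 := by
        filter_upwards [isOpen_Ioo.mem_nhds ht] with s hs using h1 s (abs_le.2 ⟨hs.1.le, hs.2.le⟩)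
      rw [this.deriv_eq, deriv_const]
    · have : Z =ᶠ[nhds t] fun _ => 0 := by
        filter_upwards [isOpen_Ioi.mem_nhds ht] with s hs using h0 s (le_of_lt hs)
      rw [this.deriv_eq, deriv_const]
  have hpc : Continuous (iteratedDeriv p (deriv Z)) := hd.continuous_iteratedDeriv p le_rfl
  obtain ⟨B, hB⟩ := isCompact_Icc.exists_bound_of_continuousOn (s := Set.Icc 0 T) hpc.continuousOn
  have hB0 : 0 ≤ B := (norm_nonneg _).trans (hB 0 ⟨le_rfl, hTpos.le⟩)
  refine ⟨B * T, by positivity, fun z hz him => ?_⟩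
  have hIz : I * z ≠ 0 := mul_ne_zero I_ne_zero hz
  have key : (∫ t in (0 : ℝ)..T, (Z t : ℂ) * Complex.exp (I * z * t)) - I / z =
      (I / z) ^ (p + 1) *
        ∫ t in (0 : ℝ)..T, ((iteratedDeriv p (deriv Z) t : ℝ) : ℂ) * Complex.exp (I * z * t) := by
    rw [pow_succ', mul_assoc, ← integral_mul_cexp_eq_iteratedDeriv p hd hU hdU h0U hTU hz]
    have hv : ∀ t : ℝ, HasDerivAt (fun t : ℝ => Complex.exp (I * z * t) / (I * z))
        (Complex.exp (I * z * t)) t := by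
      intro t
      have h1 : HasDerivAt (fun t : ℝ => I * z * (t : ℂ)) (I * z) t := by
        simpa using (Complex.ofRealCLM.hasDerivAt (x := t)).const_mul (I * z)
      have h2 := (h1.cexp).div_const (I * z)
      rwa [mul_div_cancel_right₀ _ hIz] at h2
    have hu : ∀ t : ℝ, HasDerivAt (fun t : ℝ => (Z t : ℂ)) ((deriv Z t : ℝ) : ℂ) t := fun t =>
      ((hZ1.differentiable (by norm_num)) t).hasDerivAt.ofReal_comp
    have hdc : Continuous (deriv Z) := hZ1.continuous_deriv (le_refl _)
    rw [intervalIntegral.integral_mul_deriv_eq_deriv_mul (fun t _ => hu t) (fun t _ => hv t)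
      ((by fun_prop : Continuous fun t : ℝ => ((deriv Z t : ℝ) : ℂ)).intervalIntegrable _ _)
      ((by fun_prop : Continuous fun t : ℝ => Complex.exp (I * z * t)).intervalIntegrable _ _)]
    rw [h0 T hT.le, h1 0 (by simpa using hδ.le)]
    have : ∀ t : ℝ, ((deriv Z t : ℝ) : ℂ) * (Complex.exp (I * z * t) / (I * z)) =
        -((I / z) * (((deriv Z t : ℝ) : ℂ) * Complex.exp (I * z * t))) := by
      intro t
      field_simp
      rw [I_sq]
      ring
    simp_rw [this]
    rw [intervalIntegral.integral_neg, intervalIntegral.integral_const_mul]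
    simp only [ofReal_zero, zero_mul, ofReal_one, mul_zero, Complex.exp_zero]
    field_simp
    rw [I_sq]
    ring
  rw [key, norm_mul, norm_pow, norm_div, norm_I]
  have hInt : ‖∫ t in (0 : ℝ)..T, ((iteratedDeriv p (deriv Z) t : ℝ) : ℂ) * Complex.exp (I * z * t)‖ ≤
      (B * Real.exp (-δ * z.im)) * |T - 0| := by
    refine intervalIntegral.norm_integral_le_of_norm_le_const fun t ht => ?_
    rw [Set.uIoc_of_le hTpos.le] at ht
    by_cases htδ : t < δ
    · rw [iteratedDeriv_eq_zero_of_isOpen p hU hdU t (Or.inl ⟨by linarith [ht.1], htδ⟩)]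
      simp only [ofReal_zero, zero_mul, norm_zero]
      positivity
    · rw [norm_mul, Complex.norm_exp, Complex.norm_real]
      have hre : (I * z * (t : ℂ)).re = -t * z.im := by
        simp [mul_comm]
      rw [hre]
      have := hB t ⟨ht.1.le, ht.2⟩
      gcongr
      exact not_lt.1 htδ
  rw [sub_zero, abs_of_pos hTpos] at hInt
  calc (1 / ‖z‖) ^ (p + 1) * _ ≤ (1 / ‖z‖) ^ (p + 1) * (B * Real.exp (-δ * z.im) * T) := by gcongr
    _ = _ := by rw [one_div, inv_pow]; ring

theorem betaCoef3_cases (k α₁ α₂ : ℝ) (hk : 0 < k) (n : ℤ × ℤ) :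
    0 ≤ (betaCoef3 k α₁ α₂ n).im ∧ |(betaCoef3 k α₁ α₂ n).re| ≤ k ∧
      betaCoef3 k α₁ α₂ n ^ 2 =
        ((k ^ 2 - (α₁ + (n.1 : ℝ)) ^ 2 - (α₂ + (n.2 : ℝ)) ^ 2 : ℝ) : ℂ) := by
  unfold betaCoef3
  split_ifs with h
  · refine ⟨by simp, ?_, ?_⟩
    · rw [ofReal_re, abs_of_nonneg (Real.sqrt_nonneg _)]
      refine Real.sqrt_le_iff.2 ⟨hk.le, ?_⟩
      nlinarith [sq_nonneg (α₁ + (n.1 : ℝ)), sq_nonneg (α₂ + (n.2 : ℝ))]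
    · rw [← ofReal_pow, Real.sq_sqrt (by linarith)]
  · refine ⟨by simp [Real.sqrt_nonneg], by simpa using hk.le, ?_⟩
    rw [mul_pow, ← ofReal_pow, Real.sq_sqrt (by linarith), I_sq]
    push_cast
    ring

theorem norm_betaCoef3_sub_le_im (k α₁ α₂ : ℝ) (hk : 0 < k) (n : ℤ × ℤ) :
    ‖betaCoef3 k α₁ α₂ n‖ - k ≤ (betaCoef3 k α₁ α₂ n).im := by
  obtain ⟨h1, h2, -⟩ := betaCoef3_cases k α₁ α₂ hk n
  have := Complex.norm_le_abs_re_add_abs_im (betaCoef3 k α₁ α₂ n)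
  rw [abs_of_nonneg h1] at this
  linarith

theorem le_norm_betaCoef3_add (k α₁ α₂ : ℝ) (hk : 0 < k) (n : ℤ × ℤ) (η : ℝ) :
    (‖betaCoef3 k α₁ α₂ n‖ + |η|) / 2 - k ≤ ‖betaCoef3 k α₁ α₂ n + η‖ := by
  obtain ⟨h1, h2, -⟩ := betaCoef3_cases k α₁ α₂ hk n
  have h3 := norm_betaCoef3_sub_le_im k α₁ α₂ hk n
  have h4 := (le_abs_self _).trans (Complex.abs_im_le_norm (betaCoef3 k α₁ α₂ n + η))
  have h5 := Complex.abs_re_le_norm (betaCoef3 k α₁ α₂ n + η)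
  simp only [add_im, add_re, ofReal_im, ofReal_re, add_zero] at h4 h5
  have h6 : |η| ≤ |(betaCoef3 k α₁ α₂ n).re + η| + |(betaCoef3 k α₁ α₂ n).re| := by
    calc |η| = |((betaCoef3 k α₁ α₂ n).re + η) - (betaCoef3 k α₁ α₂ n).re| := by ring_nf
      _ ≤ _ := abs_sub _ _
  linarith

/-- The coefficients `β` grow linearly once they are bounded away from zero. -/
theorem exists_le_norm_betaCoef3 (k α₁ α₂ : ℝ) (hk : 0 < k) {b : ℝ} (hb : 0 < b)
    (hβ : ∀ n : ℤ × ℤ, b ≤ ‖betaCoef3 k α₁ α₂ n‖) :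
    ∃ c₀ : ℝ, 0 < c₀ ∧ ∀ n : ℤ × ℤ,
      c₀ * (1 + |(n.1 : ℝ)| + |(n.2 : ℝ)|) ≤ ‖betaCoef3 k α₁ α₂ n‖ := by
  set A := |α₁| + |α₂| with hA
  have hA0 : 0 ≤ A := by positivity
  set R := 4 * A + 8 * k + 1 with hR
  have hR0 : 0 < R := by positivity
  refine ⟨min (1 / 8) (b / (1 + R)), by positivity, fun n => ?_⟩
  set T := |(n.1 : ℝ)| + |(n.2 : ℝ)| with hT
  have hT0 : 0 ≤ T := by positivity
  rw [add_assoc, ← hT]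
  rcases le_or_gt T R with h | h
  · calc min (1 / 8) (b / (1 + R)) * (1 + T) ≤ b / (1 + R) * (1 + R) := by
          gcongr
          exact min_le_right _ _
      _ = b := by field_simp
      _ ≤ _ := hβ n
  · have h1 : (1 + T) / 8 ≤ ‖betaCoef3 k α₁ α₂ n‖ := by
      refine le_of_sq_le_sq ?_ (norm_nonneg _)
      rw [← norm_pow, (betaCoef3_cases k α₁ α₂ hk n).2.2, Complex.norm_real, Real.norm_eq_abs]
      have hs1 : |(n.1 : ℝ)| - |α₁| ≤ |α₁ + n.1| := by
        have := abs_sub_abs_le_abs_sub (n.1 : ℝ) (-α₁)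
        rwa [abs_neg, sub_neg_eq_add, add_comm (n.1 : ℝ)] at this
      have hs2 : |(n.2 : ℝ)| - |α₂| ≤ |α₂ + n.2| := by
        have := abs_sub_abs_le_abs_sub (n.2 : ℝ) (-α₂)
        rwa [abs_neg, sub_neg_eq_add, add_comm (n.2 : ℝ)] at this
      have hs : 3 / 4 * T ≤ |α₁ + n.1| + |α₂ + n.2| := by linarith
      have hsq : (3 / 4 * T) ^ 2 / 2 ≤ (α₁ + n.1) ^ 2 + (α₂ + n.2) ^ 2 := by
        rw [← sq_abs (α₁ + n.1), ← sq_abs (α₂ + n.2)]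
        nlinarith [sq_nonneg (|α₁ + n.1| - |α₂ + n.2|), mul_self_le_mul_self (by positivity) hs]
      have hkT : k ≤ T / 8 := by linarith
      have hT1 : 1 ≤ T := by linarith
      rw [abs_of_neg]
      all_goals nlinarith
    refine le_trans ?_ h1
    have := min_le_left (1 / 8) (b / (1 + R))
    nlinarith

/-- A summable weight on the integers. -/
def intWeight (l : ℤ) : ℝ := (1 + |(l : ℝ)|) ^ (-(4 / 3) : ℝ)

theorem intWeight_nonneg (l : ℤ) : 0 ≤ intWeight l := by unfold intWeight; positivity

theorem summable_intWeight : Summable intWeight := by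
  have h : Summable fun n : ℤ => |(n : ℝ)| ^ (-(4 / 3) : ℝ) :=
    Real.summable_abs_int_rpow (by norm_num)
  refine Summable.of_norm_bounded_eventually h ?_
  filter_upwards [(Set.finite_singleton (0 : ℤ)).compl_mem_cofinite] with l hl
  have hl0 : (0 : ℝ) < |(l : ℝ)| := by
    simpa using hl
  rw [Real.norm_of_nonneg (intWeight_nonneg l)]
  exact Real.rpow_le_rpow_of_nonpos hl0 (by linarith) (by norm_num)

theorem summable_intWeight_prod : Summable fun n : ℤ × ℤ => intWeight n.1 * intWeight n.2 :=
  summable_intWeight.mul_of_nonneg summable_intWeight intWeight_nonneg intWeight_nonneg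

theorem summable_intWeight_prod_prod :
    Summable fun j : ℤ × ℤ × ℤ => intWeight j.1 * (intWeight j.2.1 * intWeight j.2.2) :=
  summable_intWeight.mul_of_nonneg (g := fun n : ℤ × ℤ => intWeight n.1 * intWeight n.2)
    summable_intWeight_prod intWeight_nonneg
    fun _ => mul_nonneg (intWeight_nonneg _) (intWeight_nonneg _)

theorem rpow_neg_le_intWeight {l : ℤ} {J : ℝ} (h : 1 + |(l : ℝ)| ≤ J) :
    J ^ (-(4 / 3) : ℝ) ≤ intWeight l :=
  Real.rpow_le_rpow_of_nonpos (by positivity) h (by norm_num)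

theorem inv_pow_le_intWeight_prod (n : ℤ × ℤ) :
    ((1 + |(n.1 : ℝ)| + |(n.2 : ℝ)|) ^ 3)⁻¹ ≤ intWeight n.1 * intWeight n.2 := by
  set J := 1 + |(n.1 : ℝ)| + |(n.2 : ℝ)| with hJ
  have hJ1 : 1 ≤ J := by rw [hJ, add_assoc]; linarith [abs_nonneg (n.1 : ℝ), abs_nonneg (n.2 : ℝ)]
  have hJ0 : 0 < J := by linarith
  calc (J ^ 3)⁻¹ = J ^ (-3 : ℝ) := by
        rw [Real.rpow_neg hJ0.le]; norm_cast
    _ ≤ J ^ (-(4 / 3) + -(4 / 3) : ℝ) := Real.rpow_le_rpow_of_exponent_le hJ1 (by norm_num)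
    _ = J ^ (-(4 / 3) : ℝ) * J ^ (-(4 / 3) : ℝ) := Real.rpow_add hJ0 _ _
    _ ≤ _ := by
      gcongr
      · exact intWeight_nonneg _
      · exact rpow_neg_le_intWeight (by linarith [abs_nonneg (n.2 : ℝ)])
      · exact rpow_neg_le_intWeight (by linarith [abs_nonneg (n.1 : ℝ)])

theorem inv_pow_four_le_intWeight_prod_prod (j : ℤ × ℤ × ℤ) :
    ((1 + |(j.1 : ℝ)| + |(j.2.1 : ℝ)| + |(j.2.2 : ℝ)|) ^ 4)⁻¹ ≤
      intWeight j.1 * (intWeight j.2.1 * intWeight j.2.2) := by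
  have h1 := abs_nonneg (j.1 : ℝ)
  have h2 := abs_nonneg (j.2.1 : ℝ)
  have h3 := abs_nonneg (j.2.2 : ℝ)
  set J := 1 + |(j.1 : ℝ)| + |(j.2.1 : ℝ)| + |(j.2.2 : ℝ)| with hJ
  have hJ0 : 0 < J := by positivity
  calc (J ^ 4)⁻¹ = J ^ (-4 : ℝ) := by
        rw [Real.rpow_neg hJ0.le]; norm_cast
    _ = J ^ (-(4 / 3) + (-(4 / 3) + -(4 / 3)) : ℝ) := by norm_num
    _ = J ^ (-(4 / 3) : ℝ) * (J ^ (-(4 / 3) : ℝ) * J ^ (-(4 / 3) : ℝ)) := by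
      rw [Real.rpow_add hJ0, Real.rpow_add hJ0]
    _ ≤ _ := by
      gcongr
      · exact intWeight_nonneg _
      · exact rpow_neg_le_intWeight (by linarith)
      · exact intWeight_nonneg _
      · exact rpow_neg_le_intWeight (by linarith)
      · exact rpow_neg_le_intWeight (by linarith)

theorem exp_neg_le_inv_pow {v : ℝ} (hv : 0 < v) (q : ℕ) :
    Real.exp (-v) ≤ q.factorial * (v ^ q)⁻¹ := by
  have h := Real.pow_div_factorial_le_exp v hv.le q
  rw [Real.exp_neg, ← inv_inv ((q.factorial : ℝ)), ← mul_inv]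
  refine inv_anti₀ (by positivity) ?_
  rwa [inv_mul_eq_div]

/-- Exponential decay in `β` dominates the summable weight. -/
theorem exists_exp_neg_norm_betaCoef3_le (k α₁ α₂ : ℝ) {c₀ : ℝ} (hc₀ : 0 < c₀)
    (h : ∀ n : ℤ × ℤ, c₀ * (1 + |(n.1 : ℝ)| + |(n.2 : ℝ)|) ≤ ‖betaCoef3 k α₁ α₂ n‖)
    {δ : ℝ} (hδ : 0 < δ) :
    ∃ C : ℝ, 0 < C ∧ ∀ n : ℤ × ℤ,
      Real.exp (-δ * ‖betaCoef3 k α₁ α₂ n‖) ≤ C * (intWeight n.1 * intWeight n.2) := by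
  refine ⟨(Nat.factorial 3 : ℝ) * ((δ * c₀) ^ 3)⁻¹, by positivity, fun n => ?_⟩
  calc Real.exp (-δ * ‖betaCoef3 k α₁ α₂ n‖)
      ≤ Real.exp (-(δ * c₀ * (1 + |(n.1 : ℝ)| + |(n.2 : ℝ)|))) := by
        rw [Real.exp_le_exp, neg_mul, neg_le_neg_iff, mul_assoc]
        gcongr
        exact h n
    _ ≤ (Nat.factorial 3 : ℝ) * ((δ * c₀ * (1 + |(n.1 : ℝ)| + |(n.2 : ℝ)|)) ^ 3)⁻¹ :=
        exp_neg_le_inv_pow (by positivity) 3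
    _ ≤ _ := by
      rw [mul_pow, mul_inv, ← mul_assoc]
      gcongr
      exact inv_pow_le_intWeight_prod n

/-- Product coordinates on three-dimensional Euclidean space. -/
def euclideanEquivProd : EuclideanSpace ℝ (Fin 3) ≃ᵐ (ℝ × ℝ) × ℝ :=
  ((MeasurableEquiv.toLp 2 (Fin 3 → ℝ)).symm.trans
    (MeasurableEquiv.piFinSuccAbove (fun _ => ℝ) 2)).trans
    (((MeasurableEquiv.refl ℝ).prodCongr MeasurableEquiv.finTwoArrow).trans
      MeasurableEquiv.prodComm)

theorem measurePreserving_euclideanEquivProd :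
    MeasurePreserving euclideanEquivProd volume volume := by
  unfold euclideanEquivProd
  refine MeasurePreserving.trans (MeasurePreserving.trans
    (EuclideanSpace.volume_preserving_symm_measurableEquiv_toLp _)
    (volume_preserving_piFinSuccAbove (fun _ => ℝ) 2)) (MeasurePreserving.trans (μb := volume) ?_ ?_)
  · exact (MeasurePreserving.id volume).prod (volume_preserving_finTwoArrow ℝ)
  · exact Measure.measurePreserving_swap

/-- The point of Euclidean space with given product coordinates. -/
def ofProd (p : (ℝ × ℝ) × ℝ) : EuclideanSpace ℝ (Fin 3) := !₂[p.1.1, p.1.2, p.2]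

theorem euclideanEquivProd_ofProd (p : (ℝ × ℝ) × ℝ) : euclideanEquivProd (ofProd p) = p := rfl

theorem ofProd_euclideanEquivProd (x : EuclideanSpace ℝ (Fin 3)) :
    ofProd (euclideanEquivProd x) = x := by
  ext i
  fin_cases i <;> rfl

theorem continuous_ofProd : Continuous ofProd := by
  unfold ofProd
  refine (PiLp.continuous_toLp 2 _).comp (continuous_pi fun i => ?_)
  fin_cases i
  · exact continuous_fst.fst
  · exact continuous_fst.snd
  · exact continuous_snd

theorem measurePreserving_ofProd : MeasurePreserving ofProd volume volume := by
  have h := measurePreserving_euclideanEquivProd.symm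
  have : (euclideanEquivProd.symm : (ℝ × ℝ) × ℝ → EuclideanSpace ℝ (Fin 3)) = ofProd := by
    ext1 p
    rw [MeasurableEquiv.symm_apply_eq, euclideanEquivProd_ofProd]
  rwa [this] at h

theorem measurableEmbedding_ofProd : MeasurableEmbedding ofProd := by
  have : (euclideanEquivProd.symm : (ℝ × ℝ) × ℝ → EuclideanSpace ℝ (Fin 3)) = ofProd := by
    ext1 p
    rw [MeasurableEquiv.symm_apply_eq, euclideanEquivProd_ofProd]
  rw [← this]
  exact euclideanEquivProd.symm.measurableEmbedding

/-- The horizontal period cell. -/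
def cell2 : Set (ℝ × ℝ) := Set.Icc (-π) π ×ˢ Set.Icc (-π) π

/-- The box in product coordinates. -/
def box3 (ct : ℝ) : Set ((ℝ × ℝ) × ℝ) := cell2 ×ˢ Set.Icc (-ct) ct

theorem ofProd_preimage_domDd (ct : ℝ) : ofProd ⁻¹' domDd ct = box3 ct := by
  ext p
  simp [ofProd, domDd, box3, cell2, -Set.Icc_prod_Icc, Set.mem_prod, and_assoc]

theorem isCompact_cell2 : IsCompact cell2 := isCompact_Icc.prod isCompact_Icc

theorem isCompact_box3 (ct : ℝ) : IsCompact (box3 ct) := isCompact_cell2.prod isCompact_Icc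

theorem setIntegral_domDd {E : Type*} [NormedAddCommGroup E] [NormedSpace ℝ E] (ct : ℝ)
    (f : EuclideanSpace ℝ (Fin 3) → E) :
    ∫ x in domDd ct, f x = ∫ p in box3 ct, f (ofProd p) := by
  rw [← ofProd_preimage_domDd]
  exact (measurePreserving_ofProd.setIntegral_preimage_emb measurableEmbedding_ofProd f _).symm

theorem integral_eq_integral_ofProd {E : Type*} [NormedAddCommGroup E] [NormedSpace ℝ E]
    (f : EuclideanSpace ℝ (Fin 3) → E) : ∫ x, f x = ∫ p, f (ofProd p) :=
  (measurePreserving_ofProd.integral_comp measurableEmbedding_ofProd f).symm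

/-- Plane waves on the horizontal period cell. -/
def wave2 (n : ℤ × ℤ) (q : ℝ × ℝ) : ℂ :=
  Complex.exp (I * n.1 * q.1) * Complex.exp (I * n.2 * q.2)

/-- Plane waves on the box. -/
def wave3 (ct : ℝ) (j : ℤ × ℤ × ℤ) (p : (ℝ × ℝ) × ℝ) : ℂ :=
  wave2 (j.1, j.2.1) p.1 * Complex.exp (I * (j.2.2 * (π / ct) : ℝ) * p.2)

theorem continuous_wave2 (n : ℤ × ℤ) : Continuous (wave2 n) := by unfold wave2; fun_prop

theorem continuous_wave3 (ct : ℝ) (j : ℤ × ℤ × ℤ) : Continuous (wave3 ct j) := by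
  unfold wave3 wave2; fun_prop

theorem norm_cexp_I_mul_ofReal_mul (a t : ℝ) : ‖Complex.exp (I * a * t)‖ = 1 := by
  rw [Complex.norm_exp]
  simp

theorem norm_cexp_I_mul_intCast_mul (a : ℤ) (t : ℝ) : ‖Complex.exp (I * a * t)‖ = 1 := by
  rw [Complex.norm_exp]
  simp

theorem norm_wave2 (n : ℤ × ℤ) (q : ℝ × ℝ) : ‖wave2 n q‖ = 1 := by
  rw [wave2, norm_mul, norm_cexp_I_mul_intCast_mul, norm_cexp_I_mul_intCast_mul, mul_one]

theorem norm_wave3 (ct : ℝ) (j : ℤ × ℤ × ℤ) (p : (ℝ × ℝ) × ℝ) : ‖wave3 ct j p‖ = 1 := by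
  rw [wave3, norm_mul, norm_wave2, norm_cexp_I_mul_ofReal_mul, mul_one]

theorem wave2_mul (m n : ℤ × ℤ) (q : ℝ × ℝ) : wave2 m q * wave2 n q = wave2 (m + n) q := by
  simp only [wave2, ← Complex.exp_add]
  congr 1
  push_cast [Prod.fst_add, Prod.snd_add]
  ring

theorem wave3_mul (ct : ℝ) (i j : ℤ × ℤ × ℤ) (p : (ℝ × ℝ) × ℝ) :
    wave3 ct i p * wave3 ct j p = wave3 ct (i + j) p := by
  simp only [wave3, wave2, ← Complex.exp_add]
  congr 1
  push_cast [Prod.fst_add, Prod.snd_add]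
  ring

theorem conj_wave2 (n : ℤ × ℤ) (q : ℝ × ℝ) :
    (starRingEnd ℂ) (wave2 n q) = wave2 (-n) q := by
  simp only [wave2, ← Complex.exp_add, ← Complex.exp_conj]
  congr 1
  simp

theorem integral_cexp_I_mul_int (L : ℝ) (hL : 0 < L) (n : ℤ) :
    ∫ t in Set.Icc (-L) L, Complex.exp (I * (n * (π / L) : ℝ) * t) =
      if n = 0 then ((2 * L : ℝ) : ℂ) else 0 := by
  rw [integral_Icc_eq_integral_Ioc, ← intervalIntegral.integral_of_le (by linarith)]
  split_ifs with h
  · simp [h]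
    ring
  · have hc : I * ((n * (π / L) : ℝ) : ℂ) ≠ 0 := by
      have : (n : ℝ) * (π / L) ≠ 0 :=
        mul_ne_zero (by exact_mod_cast h) (div_pos Real.pi_pos hL).ne'
      exact mul_ne_zero I_ne_zero (by exact_mod_cast this)
    rw [integral_exp_mul_complex hc]
    have h1 : I * ((n * (π / L) : ℝ) : ℂ) * (L : ℂ) = n * π * I := by
      have : (L : ℂ) ≠ 0 := by exact_mod_cast hL.ne'
      push_cast
      field_simp
    have h2 : I * ((n * (π / L) : ℝ) : ℂ) * ((-L : ℝ) : ℂ) =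
        n * π * I - n * (2 * π * I) := by
      rw [ofReal_neg, mul_neg, h1]
      ring
    rw [h1, h2, Complex.exp_sub, Complex.exp_int_mul_two_pi_mul_I]
    simp

theorem integral_wave2 (n : ℤ × ℤ) :
    ∫ q in cell2, wave2 n q = if n = 0 then ((4 * π ^ 2 : ℝ) : ℂ) else 0 := by
  unfold cell2 wave2
  rw [Measure.volume_eq_prod, setIntegral_prod_mul (fun t : ℝ => Complex.exp (I * n.1 * t))
    (fun t : ℝ => Complex.exp (I * n.2 * t))]
  have h := integral_cexp_I_mul_int π Real.pi_pos
  simp only [div_self Real.pi_ne_zero, mul_one, ofReal_intCast] at h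
  rw [h, h]
  rcases n with ⟨a, b⟩
  by_cases ha : a = 0 <;> by_cases hb : b = 0 <;> simp [ha, hb]
  ring

theorem integral_wave3 (ct : ℝ) (hct : 0 < ct) (j : ℤ × ℤ × ℤ) :
    ∫ p in box3 ct, wave3 ct j p = if j = 0 then ((8 * π ^ 2 * ct : ℝ) : ℂ) else 0 := by
  unfold box3 wave3
  rw [Measure.volume_eq_prod, setIntegral_prod_mul (fun q => wave2 (j.1, j.2.1) q)
    (fun t : ℝ => Complex.exp (I * (j.2.2 * (π / ct) : ℝ) * t)), integral_wave2,
    integral_cexp_I_mul_int ct hct]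
  rcases j with ⟨a, b, c⟩
  by_cases ha : a = 0 <;> by_cases hb : b = 0 <;> by_cases hc : c = 0 <;> simp [ha, hb, hc]
  ring

theorem fBasis3_ofProd (ct : ℝ) (j : ℤ × ℤ × ℤ) (p : (ℝ × ℝ) × ℝ) :
    fBasis3 ct j (ofProd p) = ((1 / Real.sqrt (8 * π ^ 2 * ct) : ℝ) : ℂ) * wave3 ct j p := by
  unfold fBasis3 wave3 wave2 ofProd
  rw [← Complex.exp_add, ← Complex.exp_add]
  congr 2
  simp
  ring

/-- The projection of the box onto the three-dimensional torus. -/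
def toTorus (ct : ℝ) (p : (ℝ × ℝ) × ℝ) : UnitAddTorus (Fin 3) :=
  ![((p.1.1 / (2 * π) : ℝ) : UnitAddCircle), ((p.1.2 / (2 * π) : ℝ) : UnitAddCircle),
    ((p.2 / (2 * ct) : ℝ) : UnitAddCircle)]

theorem continuous_toTorus (ct : ℝ) : Continuous (toTorus ct) := by
  refine continuous_pi fun i => ?_
  fin_cases i
  · exact (AddCircle.continuous_mk' 1).comp (continuous_fst.fst.div_const _)
  · exact (AddCircle.continuous_mk' 1).comp (continuous_fst.snd.div_const _)
  · exact (AddCircle.continuous_mk' 1).comp (continuous_snd.div_const _)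

theorem mFourier_toTorus {ct : ℝ} (hct : 0 < ct) (n : Fin 3 → ℤ) (p : (ℝ × ℝ) × ℝ) :
    UnitAddTorus.mFourier n (toTorus ct p) = wave3 ct (n 0, n 1, n 2) p := by
  have hπ : (π : ℂ) ≠ 0 := by exact_mod_cast Real.pi_ne_zero
  have hc : (ct : ℂ) ≠ 0 := by exact_mod_cast hct.ne'
  simp only [UnitAddTorus.mFourier, ContinuousMap.coe_mk, Fin.prod_univ_three, toTorus,
    Matrix.cons_val_zero, Matrix.cons_val_one, Matrix.cons_val, wave3, wave2]
  rw [fourier_coe_apply, fourier_coe_apply, fourier_coe_apply]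
  congr 1
  · congr 1 <;> congr 1 <;> push_cast <;> field_simp
  · congr 1
    push_cast
    field_simp

theorem interior_box3 (ct : ℝ) : interior (box3 ct) =
    (Set.Ioo (-π) π ×ˢ Set.Ioo (-π) π) ×ˢ Set.Ioo (-ct) ct := by
  unfold box3 cell2
  rw [interior_prod_eq, interior_prod_eq, interior_Icc, interior_Icc]

theorem exists_mem_Icc_coe_div_eq {L : ℝ} (hL : 0 < L) (y : UnitAddCircle) :
    ∃ t ∈ Set.Icc (-L) L, ((t / (2 * L) : ℝ) : UnitAddCircle) = y := by
  have h : y ∈ ((↑) : ℝ → UnitAddCircle) '' Set.Icc (-(1 / 2)) (-(1 / 2) + 1) := by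
    rw [AddCircle.coe_image_Icc_eq]
    trivial
  obtain ⟨s, ⟨hs1, hs2⟩, rfl⟩ := h
  refine ⟨s * (2 * L), ⟨by nlinarith, by nlinarith⟩, ?_⟩
  rw [mul_div_cancel_right₀ _ (by positivity)]

theorem eq_of_coe_div_eq {L s t : ℝ} (hL : 0 < L) (hs : s ∈ Set.Ioo (-L) L)
    (ht : t ∈ Set.Icc (-L) L)
    (h : ((s / (2 * L) : ℝ) : UnitAddCircle) = ((t / (2 * L) : ℝ) : UnitAddCircle)) : s = t := by
  rw [← sub_eq_zero, ← AddCircle.coe_sub, AddCircle.coe_eq_zero_iff] at h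
  obtain ⟨n, hn⟩ := h
  rw [zsmul_eq_mul, mul_one, ← sub_div, eq_div_iff (by positivity)] at hn
  have h1 : (n : ℝ) < 1 := by
    by_contra! h'
    nlinarith [hs.2, ht.1]
  have h2 : (-1 : ℝ) < n := by
    by_contra! h'
    nlinarith [hs.1, ht.2]
  have h3 : n = 0 := by
    have h1' : n < 1 := by exact_mod_cast h1
    have h2' : -1 < n := by exact_mod_cast h2
    omega
  rw [h3] at hn
  simp only [Int.cast_zero, zero_mul] at hn
  linarith

theorem eq_of_toTorus_eq {ct : ℝ} (hct : 0 < ct) {p q : (ℝ × ℝ) × ℝ}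
    (hp : p ∈ interior (box3 ct)) (hq : q ∈ box3 ct) (h : toTorus ct p = toTorus ct q) :
    p = q := by
  rw [interior_box3] at hp
  obtain ⟨⟨hp1, hp2⟩, hp3⟩ := hp
  obtain ⟨⟨hq1, hq2⟩, hq3⟩ := hq
  exact Prod.ext (Prod.ext (eq_of_coe_div_eq Real.pi_pos hp1 hq1 (congrFun h 0))
    (eq_of_coe_div_eq Real.pi_pos hp2 hq2 (congrFun h 1)))
    (eq_of_coe_div_eq hct hp3 hq3 (congrFun h 2))

theorem surjective_toTorus_restrict {ct : ℝ} (hct : 0 < ct) :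
    Function.Surjective fun p : box3 ct => toTorus ct p := by
  intro y
  obtain ⟨s, hs, hs'⟩ := exists_mem_Icc_coe_div_eq Real.pi_pos (y 0)
  obtain ⟨t, ht, ht'⟩ := exists_mem_Icc_coe_div_eq Real.pi_pos (y 1)
  obtain ⟨u, hu, hu'⟩ := exists_mem_Icc_coe_div_eq hct (y 2)
  refine ⟨⟨((s, t), u), ⟨⟨hs, ht⟩, hu⟩⟩, ?_⟩
  ext i
  fin_cases i
  · exact hs'
  · exact ht'
  · exact hu'

/-- An integrable function on the box annihilating all plane waves annihilates all continuous
functions on the torus. -/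
theorem integral_comp_toTorus_mul_eq_zero {ct : ℝ} (hct : 0 < ct) {D : (ℝ × ℝ) × ℝ → ℂ}
    (hD : IntegrableOn D (box3 ct)) (h : ∀ j, ∫ p in box3 ct, wave3 ct j p * D p = 0)
    (G : C(UnitAddTorus (Fin 3), ℂ)) : ∫ p in box3 ct, G (toTorus ct p) * D p = 0 := by
  have hInt : ∀ G : C(UnitAddTorus (Fin 3), ℂ),
      IntegrableOn (fun p => G (toTorus ct p) * D p) (box3 ct) := fun G => by
    refine hD.bdd_mul (c := ‖G‖) (G.continuous.comp (continuous_toTorus ct)).aestronglyMeasurable ?_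
    exact Filter.Eventually.of_forall fun p => G.norm_coe_le_norm _
  let Λ : C(UnitAddTorus (Fin 3), ℂ) →L[ℂ] ℂ := LinearMap.mkContinuous
    { toFun := fun G => ∫ p in box3 ct, G (toTorus ct p) * D p
      map_add' := fun G H => by
        rw [← integral_add (hInt G) (hInt H)]
        congr 1
        ext p
        simp [add_mul]
      map_smul' := fun a G => by
        rw [RingHom.id_apply, smul_eq_mul, ← integral_const_mul]
        congr 1
        ext p
        simp [mul_assoc] } (∫ p in box3 ct, ‖D p‖) (fun G => by
      rw [← integral_mul_const]
      refine norm_integral_le_of_norm_le (hD.norm.mul_const _) ?_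
      refine Filter.Eventually.of_forall fun p => ?_
      rw [norm_mul, mul_comm]
      gcongr
      exact G.norm_coe_le_norm _)
  have hker : (⊤ : Submodule ℂ C(UnitAddTorus (Fin 3), ℂ)) ≤ LinearMap.ker Λ.toLinearMap := by
    rw [← UnitAddTorus.span_mFourier_closure_eq_top]
    refine Submodule.topologicalClosure_minimal _ ?_ Λ.isClosed_ker
    rw [Submodule.span_le]
    rintro _ ⟨n, rfl⟩
    change ∫ p in box3 ct, UnitAddTorus.mFourier n (toTorus ct p) * D p = 0
    simp_rw [mFourier_toTorus hct]
    exact h _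
  exact hker (Submodule.mem_top (x := G))

/-- Uniqueness of Fourier coefficients for integrable functions on the box. -/
theorem ae_eq_zero_of_integral_wave3_mul_eq_zero {ct : ℝ} (hct : 0 < ct)
    {D : (ℝ × ℝ) × ℝ → ℂ} (hD : IntegrableOn D (box3 ct))
    (h : ∀ j, ∫ p in box3 ct, wave3 ct j p * D p = 0) :
    ∀ᵐ p, p ∈ interior (box3 ct) → D p = 0 := by
  refine isOpen_interior.ae_eq_zero_of_integral_contDiff_smul_eq_zero
    (hD.mono_set interior_subset).locallyIntegrableOn fun g hg _ hgU => ?_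
  have : CompactSpace (box3 ct) := isCompact_iff_compactSpace.1 (isCompact_box3 ct)
  let Q : C(box3 ct, UnitAddTorus (Fin 3)) :=
    ⟨fun p => toTorus ct p, (continuous_toTorus ct).comp continuous_subtype_val⟩
  have hQ : Topology.IsQuotientMap Q :=
    Q.continuous.isClosedMap.isQuotientMap Q.continuous (surjective_toTorus_restrict hct)
  let gs : C(box3 ct, ℂ) := ⟨fun p => (g p : ℂ), by
    have := hg.continuous
    fun_prop⟩
  have hfac : Function.FactorsThrough gs Q := by
    intro p q hpq
    by_cases hp : (p : (ℝ × ℝ) × ℝ) ∈ interior (box3 ct)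
    · rw [Subtype.ext (eq_of_toTorus_eq hct hp q.2 hpq)]
    · by_cases hq : (q : (ℝ × ℝ) × ℝ) ∈ interior (box3 ct)
      · rw [Subtype.ext (eq_of_toTorus_eq hct hq p.2 hpq.symm)]
      · change (g p : ℂ) = (g q : ℂ)
        rw [image_eq_zero_of_notMem_tsupport fun hm => hp (hgU hm),
          image_eq_zero_of_notMem_tsupport fun hm => hq (hgU hm)]
  have hG := integral_comp_toTorus_mul_eq_zero hct hD h (hQ.lift gs hfac)
  rw [← setIntegral_eq_integral_of_forall_compl_eq_zero (s := box3 ct), ← hG]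
  · refine setIntegral_congr_fun (isCompact_box3 ct).measurableSet fun p hp => ?_
    have : hQ.lift gs hfac (toTorus ct p) = (g p : ℂ) :=
      DFunLike.congr_fun (hQ.lift_comp gs hfac) ⟨p, hp⟩
    simp only [this, Complex.real_smul]
  · intro p hp
    rw [image_eq_zero_of_notMem_tsupport fun hm => hp (interior_subset (hgU hm)), zero_smul]

theorem integral_neg_self_eq_integral_add {f : ℝ → ℂ} {T : ℝ}
    (hf : IntervalIntegrable f volume (-T) 0) (hf' : IntervalIntegrable f volume 0 T) :
    ∫ t in (-T)..T, f t = ∫ t in (0 : ℝ)..T, (f t + f (-t)) := by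
  have h : IntervalIntegrable (fun t => f (-t)) volume 0 T := by
    simpa using (hf.comp_sub_left 0).symm
  rw [← intervalIntegral.integral_add_adjacent_intervals hf hf',
    intervalIntegral.integral_add hf' h, intervalIntegral.integral_comp_neg, neg_zero, add_comm]

theorem integrable_radial_div_norm {h : ℝ → ℂ} (hc : Continuous h) {T : ℝ}
    (hT : ∀ r, T ≤ r → h r = 0) :
    Integrable fun x : EuclideanSpace ℝ (Fin 3) => h ‖x‖ / (4 * π * ‖x‖) := by
  rw [integrable_fun_norm_addHaar volume (f := fun r : ℝ => h r / (4 * π * r))]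
  have h1 : IntegrableOn (fun r : ℝ => (r : ℂ) * h r / (4 * π)) (Set.Ioi 0) := by
    have h2 : IntegrableOn (fun r : ℝ => (r : ℂ) * h r / (4 * π)) (Set.Icc 0 T) :=
      (by fun_prop : Continuous fun r : ℝ => (r : ℂ) * h r / (4 * π)).continuousOn.integrableOn_Icc
    refine h2.of_forall_sdiff_eq_zero measurableSet_Ioi fun r hr => ?_
    have : T ≤ r := by
      by_contra! h'
      exact hr.2 ⟨(le_of_lt hr.1 : (0 : ℝ) ≤ r), h'.le⟩
    simp [hT r this]
  refine h1.congr_fun (fun r hr => ?_) measurableSet_Ioi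
  have hr0 : (r : ℂ) ≠ 0 := by exact_mod_cast (ne_of_gt hr)
  simp only [finrank_euclideanSpace, Fintype.card_fin, Complex.real_smul]
  have hπ : (π : ℂ) ≠ 0 := by exact_mod_cast Real.pi_ne_zero
  push_cast
  field_simp

theorem norm_ofProd (p : (ℝ × ℝ) × ℝ) :
    ‖ofProd p‖ = Real.sqrt (p.1.1 ^ 2 + p.1.2 ^ 2 + p.2 ^ 2) := by
  rw [EuclideanSpace.norm_eq]
  simp [Fin.sum_univ_three, ofProd]

/-- Integral of a radial profile over a horizontal plane. -/
theorem integral_radial_slice {h : ℝ → ℂ} (hc : Continuous h) {T : ℝ} (hT0 : 0 < T)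
    (hT : ∀ r, T ≤ r → h r = 0) {t : ℝ} (ht : t ≠ 0) :
    ∫ q : ℝ × ℝ, h ‖ofProd (q, t)‖ / (4 * π * ‖ofProd (q, t)‖) =
      (1 / 2) * ((∫ r in (0 : ℝ)..T, h r) - ∫ r in (0 : ℝ)..|t|, h r) := by
  have hpos : ∀ s : ℝ, 0 < s ^ 2 + t ^ 2 := fun s => by positivity
  rw [← integral_comp_polarCoord_symm]
  have hInt : ∀ p : ℝ × ℝ, p.1 • (h ‖ofProd (polarCoord.symm p, t)‖ /
      (4 * π * ‖ofProd (polarCoord.symm p, t)‖)) =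
      (fun s : ℝ => (s : ℂ) * (h (Real.sqrt (s ^ 2 + t ^ 2)) /
        (4 * π * (Real.sqrt (s ^ 2 + t ^ 2) : ℝ)))) p.1 * (fun _ : ℝ => (1 : ℂ)) p.2 := by
    intro p
    have : ‖ofProd (polarCoord.symm p, t)‖ = Real.sqrt (p.1 ^ 2 + t ^ 2) := by
      rw [norm_ofProd, polarCoord_symm_apply]
      congr 1
      dsimp only
      nlinarith [Real.sin_sq_add_cos_sq p.2]
    simp only [this, mul_one, Complex.real_smul]
  simp_rw [hInt]
  rw [show polarCoord.target = Set.Ioi (0 : ℝ) ×ˢ Set.Ioo (-π) π from rfl,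
    Measure.volume_eq_prod, setIntegral_prod_mul (fun s : ℝ => (s : ℂ) *
      (h (Real.sqrt (s ^ 2 + t ^ 2)) / (4 * π * (Real.sqrt (s ^ 2 + t ^ 2) : ℝ))))
      (fun _ : ℝ => (1 : ℂ))]
  have hderiv : ∀ s : ℝ, HasDerivAt
      (fun s : ℝ => ∫ r in (0 : ℝ)..Real.sqrt (s ^ 2 + t ^ 2), h r)
      ((s / Real.sqrt (s ^ 2 + t ^ 2)) • h (Real.sqrt (s ^ 2 + t ^ 2))) s := by
    intro s
    have h1 : HasDerivAt (fun s : ℝ => Real.sqrt (s ^ 2 + t ^ 2))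
        (s / Real.sqrt (s ^ 2 + t ^ 2)) s := by
      have := (((hasDerivAt_pow 2 s).add_const (t ^ 2)).sqrt (hpos s).ne')
      convert this using 1
      push_cast
      field_simp
    exact HasDerivAt.scomp s (hc.integral_hasStrictDerivAt 0 _).hasDerivAt h1
  have hsc : Continuous fun s : ℝ => Real.sqrt (s ^ 2 + t ^ 2) := by fun_prop
  have hs0 : ∀ s : ℝ, Real.sqrt (s ^ 2 + t ^ 2) ≠ 0 := fun s => (Real.sqrt_pos.2 (hpos s)).ne'
  have hrad : ∫ s in Set.Ioi (0 : ℝ), (s : ℂ) * (h (Real.sqrt (s ^ 2 + t ^ 2)) /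
        (4 * π * (Real.sqrt (s ^ 2 + t ^ 2) : ℝ))) =
      (1 / (4 * π)) * ((∫ r in (0 : ℝ)..T, h r) - ∫ r in (0 : ℝ)..|t|, h r) := by
    have hftc := intervalIntegral.integral_eq_sub_of_hasDerivAt (a := 0) (b := T)
      (fun s _ => hderiv s)
      ((by
        exact (continuous_id.div hsc hs0).smul (hc.comp hsc) :
        Continuous fun s : ℝ => (s / Real.sqrt (s ^ 2 + t ^ 2)) •
          h (Real.sqrt (s ^ 2 + t ^ 2))).intervalIntegrable _ _)
    have htail : ∀ u, T ≤ u → ∫ r in (0 : ℝ)..u, h r = ∫ r in (0 : ℝ)..T, h r := fun u hu => by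
      rw [← intervalIntegral.integral_add_adjacent_intervals (hc.intervalIntegrable 0 T)
        (hc.intervalIntegrable T u), intervalIntegral.integral_congr (a := T) (g := fun _ => 0)]
      · simp
      · intro r hr
        rw [Set.uIcc_of_le hu] at hr
        exact hT r hr.1
    have hle : ∀ s : ℝ, s ≤ Real.sqrt (s ^ 2 + t ^ 2) := fun s =>
      Real.le_sqrt_of_sq_le (by nlinarith [sq_nonneg t])
    rw [htail _ (hle T), zero_pow two_ne_zero, zero_add, Real.sqrt_sq_eq_abs] at hftc
    rw [← hftc, ← intervalIntegral.integral_const_mul, intervalIntegral.integral_of_le hT0.le]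
    rw [setIntegral_eq_of_subset_of_forall_sdiff_eq_zero measurableSet_Ioi
      (Set.Ioc_subset_Ioi_self : Set.Ioc 0 T ⊆ Set.Ioi 0)]
    · refine setIntegral_congr_fun measurableSet_Ioc fun s _ => ?_
      have h0 : ((Real.sqrt (s ^ 2 + t ^ 2) : ℝ) : ℂ) ≠ 0 := by exact_mod_cast hs0 s
      have hπ : (π : ℂ) ≠ 0 := by exact_mod_cast Real.pi_ne_zero
      simp only [Complex.real_smul]
      push_cast
      field_simp
    · intro s hs
      have : T ≤ s := by
        by_contra! h'
        exact hs.2 ⟨hs.1, h'.le⟩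
      rw [hT _ (this.trans (hle s))]
      simp
  rw [hrad]
  have hπ : (π : ℂ) ≠ 0 := by exact_mod_cast Real.pi_ne_zero
  simp
  rw [max_eq_left (by positivity)]
  push_cast
  field_simp
  ring

theorem integral_radial_mul_cexp_vertical {h : ℝ → ℂ} (hc : Continuous h) {T : ℝ} (hT0 : 0 < T)
    (hT : ∀ r, T ≤ r → h r = 0) {ρ : ℝ} (hρ : ρ ≠ 0) :
    ∫ x : EuclideanSpace ℝ (Fin 3), h ‖x‖ / (4 * π * ‖x‖) * Complex.exp (-I * (ρ * x 2 : ℝ)) =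
      (1 / ρ) * ∫ r in (0 : ℝ)..T, h r * Complex.sin (ρ * r) := by
  have hρ' : (ρ : ℂ) ≠ 0 := by exact_mod_cast hρ
  have hInt : Integrable fun x : EuclideanSpace ℝ (Fin 3) =>
      h ‖x‖ / (4 * π * ‖x‖) * Complex.exp (-I * (ρ * x 2 : ℝ)) := by
    refine (integrable_radial_div_norm hc hT).mul_bdd (c := 1)
      (by fun_prop : Continuous fun x : EuclideanSpace ℝ (Fin 3) =>
        Complex.exp (-I * (ρ * x 2 : ℝ))).aestronglyMeasurable ?_
    refine Filter.Eventually.of_forall fun x => le_of_eq ?_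
    rw [Complex.norm_exp]
    simp
  have hIntP : Integrable fun p : (ℝ × ℝ) × ℝ =>
      h ‖ofProd p‖ / (4 * π * ‖ofProd p‖) * Complex.exp (-I * (ρ * p.2 : ℝ)) :=
    measurePreserving_ofProd.integrable_comp_of_integrable hInt
  rw [integral_eq_integral_ofProd]
  set W : ℝ → ℂ := fun t => (∫ r in (0 : ℝ)..T, h r) - ∫ r in (0 : ℝ)..t, h r with hW
  have hWd : ∀ t, HasDerivAt W (-h t) t := fun t =>
    ((hc.integral_hasStrictDerivAt 0 t).hasDerivAt).const_sub _
  have hWc : Continuous W := continuous_iff_continuousAt.2 fun t => (hWd t).continuousAt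
  have hW0 : ∀ t, T ≤ t → W t = 0 := fun t ht => by
    rw [hW]
    simp only
    rw [← intervalIntegral.integral_add_adjacent_intervals (hc.intervalIntegrable 0 T)
      (hc.intervalIntegrable T t), intervalIntegral.integral_congr (a := T) (g := fun _ => 0)]
    · simp
    · intro r hr
      rw [Set.uIcc_of_le ht] at hr
      exact hT r hr.1
  have hinner : ∀ t : ℝ, t ≠ 0 → ∫ q : ℝ × ℝ, h ‖ofProd (q, t)‖ / (4 * π * ‖ofProd (q, t)‖) *
      Complex.exp (-I * (ρ * t : ℝ)) = 1 / 2 * W |t| * Complex.exp (-I * (ρ * t : ℝ)) := by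
    intro t ht
    rw [integral_mul_const, integral_radial_slice hc hT0 hT ht]
  calc ∫ p : (ℝ × ℝ) × ℝ, h ‖ofProd p‖ / (4 * π * ‖ofProd p‖) * Complex.exp (-I * (ρ * p.2 : ℝ))
      = ∫ t : ℝ, ∫ q : ℝ × ℝ, h ‖ofProd (q, t)‖ / (4 * π * ‖ofProd (q, t)‖) *
          Complex.exp (-I * (ρ * t : ℝ)) := integral_prod_symm _ hIntP
    _ = ∫ t : ℝ, 1 / 2 * W |t| * Complex.exp (-I * (ρ * t : ℝ)) := by
        refine integral_congr_ae ?_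
        filter_upwards [Measure.ae_ne volume (0 : ℝ)] with t ht using hinner t ht
    _ = ∫ t in (-T)..T, 1 / 2 * W |t| * Complex.exp (-I * (ρ * t : ℝ)) := by
        rw [intervalIntegral.integral_of_le (by linarith), ← integral_Icc_eq_integral_Ioc,
          setIntegral_eq_integral_of_forall_compl_eq_zero]
        intro t ht
        rw [hW0 _ (by
          by_contra! h'
          exact ht ⟨(abs_lt.1 h').1.le, (abs_lt.1 h').2.le⟩)]
        simp
    _ = ∫ t in (0 : ℝ)..T, W t * Complex.cos (ρ * t) := by
        have hcont : Continuous fun t : ℝ => 1 / 2 * W |t| * Complex.exp (-I * (ρ * t : ℝ)) := by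
          fun_prop
        rw [integral_neg_self_eq_integral_add (hcont.intervalIntegrable _ _)
          (hcont.intervalIntegrable _ _)]
        refine intervalIntegral.integral_congr fun t ht => ?_
        rw [Set.uIcc_of_le hT0.le] at ht
        simp only [abs_neg, abs_of_nonneg ht.1, Complex.cos]
        push_cast
        ring_nf
    _ = (1 / ρ) * ∫ r in (0 : ℝ)..T, h r * Complex.sin (ρ * r) := by
        have hv : ∀ t : ℝ, HasDerivAt (fun t : ℝ => Complex.sin (ρ * t) / ρ)
            (Complex.cos (ρ * t)) t := by
          intro t
          have h1 : HasDerivAt (fun t : ℝ => (ρ : ℂ) * (t : ℂ)) ρ t := by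
            simpa using (Complex.ofRealCLM.hasDerivAt (x := t)).const_mul (ρ : ℂ)
          have h2 := ((Complex.hasDerivAt_sin _).comp t h1).div_const (ρ : ℂ)
          rwa [mul_div_cancel_right₀ _ hρ'] at h2
        rw [intervalIntegral.integral_mul_deriv_eq_deriv_mul (fun t _ => hWd t) (fun t _ => hv t)
          ((by fun_prop : Continuous fun t : ℝ => -h t).intervalIntegrable _ _)
          ((by fun_prop : Continuous fun t : ℝ => Complex.cos (ρ * t)).intervalIntegrable _ _)]
        rw [hW0 T le_rfl, ← intervalIntegral.integral_const_mul, ofReal_zero, mul_zero,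
          Complex.sin_zero, zero_div, mul_zero, zero_mul, sub_zero, zero_sub,
          ← intervalIntegral.integral_neg]
        congr 1
        ext t
        ring

/-- The Fourier transform of a radial function of three variables. -/
theorem integral_radial_mul_cexp {h : ℝ → ℂ} (hc : Continuous h) {T : ℝ} (hT0 : 0 < T)
    (hT : ∀ r, T ≤ r → h r = 0) {ξ : EuclideanSpace ℝ (Fin 3)} (hξ : ξ ≠ 0) :
    ∫ x : EuclideanSpace ℝ (Fin 3),
        h ‖x‖ / (4 * π * ‖x‖) * Complex.exp (-I * (inner ℝ ξ x : ℝ)) =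
      (1 / ‖ξ‖) * ∫ r in (0 : ℝ)..T, h r * Complex.sin (‖ξ‖ * r) := by
  rw [← integral_radial_mul_cexp_vertical hc hT0 hT (norm_ne_zero_iff.2 hξ)]
  set v : EuclideanSpace ℝ (Fin 3) := EuclideanSpace.single 2 ‖ξ‖ with hv
  have hnorm : ‖ξ‖ = ‖v‖ := by simp [hv]
  set R := (Submodule.span ℝ {ξ - v})ᗮ.reflection with hR
  have hRξ : R ξ = v := Submodule.reflection_sub hnorm
  have hmp : MeasurePreserving R volume volume := R.measurePreserving
  rw [← hmp.integral_comp R.toHomeomorph.measurableEmbedding]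
  congr 1
  ext x
  rw [R.norm_map]
  have : inner ℝ ξ (R x) = ‖ξ‖ * x 2 := by
    rw [← R.inner_map_map, Submodule.reflection_reflection, hRξ, hv,
      EuclideanSpace.inner_single_left]
    simp
  rw [this]

/-- The half-line Fourier integral of a cut-off, truncated at `T`. -/
def cutoffIntegral (Z : ℝ → ℝ) (T : ℝ) (z : ℂ) : ℂ :=
  ∫ t in (0 : ℝ)..T, (Z t : ℂ) * Complex.exp (I * z * t)

/-- The normalisation constant of the Fourier basis. -/
def basisNorm (ct : ℝ) : ℝ := 1 / Real.sqrt (8 * π ^ 2 * ct)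

theorem basisNorm_pos {ct : ℝ} (hct : 0 < ct) : 0 < basisNorm ct := by
  unfold basisNorm; positivity

/-- The shifted frequency vector. -/
def freqVec (α₁ α₂ ct : ℝ) (j : ℤ × ℤ × ℤ) : EuclideanSpace ℝ (Fin 3) :=
  !₂[α₁ + j.1, α₂ + j.2.1, j.2.2 * (π / ct)]

theorem norm_freqVec_sq (α₁ α₂ ct : ℝ) (j : ℤ × ℤ × ℤ) :
    ‖freqVec α₁ α₂ ct j‖ ^ 2 =
      (α₁ + j.1) ^ 2 + (α₂ + j.2.1) ^ 2 + (j.2.2 * (π / ct)) ^ 2 := by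
  rw [EuclideanSpace.norm_eq, Real.sq_sqrt (by positivity)]
  simp [Fin.sum_univ_three, freqVec]

section Singularity

variable {k α₁ α₂ ct ε : ℝ} {𝒴 : ℝ → ℝ}

theorem funF3_eq_radial (x : EuclideanSpace ℝ (Fin 3)) :
    funF3 k α₁ α₂ 𝒴 x =
      Complex.exp (-Complex.I * (α₁ : ℂ) * (x 0 : ℂ) - Complex.I * (α₂ : ℂ) * (x 1 : ℂ)) *
      ((fun r : ℝ => Complex.exp (I * k * r) * (𝒴 r : ℂ)) ‖x‖ / (4 * π * ‖x‖)) := by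
  unfold funF3
  ring

theorem integrable_funF3 (h𝒴 : Continuous 𝒴) (h𝒴0 : ∀ t : ℝ, 2 * ε ≤ t → 𝒴 t = 0) :
    Integrable (funF3 k α₁ α₂ 𝒴) := by
  have h := integrable_radial_div_norm (h := fun r : ℝ => Complex.exp (I * k * r) * (𝒴 r : ℂ))
    (by fun_prop) (T := 2 * ε) (fun r hr => by simp [h𝒴0 r hr])
  have h2 := h.bdd_mul (c := 1)
    (by fun_prop : Continuous fun x : EuclideanSpace ℝ (Fin 3) =>
      Complex.exp (-Complex.I * (α₁ : ℂ) * (x 0 : ℂ) -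
        Complex.I * (α₂ : ℂ) * (x 1 : ℂ))).aestronglyMeasurable
    (Filter.Eventually.of_forall fun x => by
      rw [Complex.norm_exp]
      simp)
  exact h2.congr (Filter.Eventually.of_forall fun x => (funF3_eq_radial x).symm)

theorem continuousOn_funF3 (h𝒴 : Continuous 𝒴) : ContinuousOn (funF3 k α₁ α₂ 𝒴) {0}ᶜ := by
  unfold funF3
  refine ContinuousOn.mul (ContinuousOn.mul (by fun_prop) (ContinuousOn.div (by fun_prop)
    (by fun_prop) fun x hx => ?_)) (by fun_prop)
  have h1 : (‖x‖ : ℂ) ≠ 0 := by exact_mod_cast norm_ne_zero_iff.2 hx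
  have h2 : (π : ℂ) ≠ 0 := by exact_mod_cast Real.pi_ne_zero
  simp [h1, h2]

theorem two_mul_le_norm_of_notMem_domDd (hε' : ε < min 1 ct / 2)
    {x : EuclideanSpace ℝ (Fin 3)} (hx : x ∉ domDd ct) : 2 * ε ≤ ‖x‖ := by
  have h1 : 2 * ε < 1 := by linarith [min_le_left 1 ct]
  have h2 : 2 * ε < ct := by linarith [min_le_right 1 ct]
  by_contra! h
  have hi : ∀ i, |x i| < 2 * ε := fun i => lt_of_le_of_lt (PiLp.norm_apply_le x i) h
  refine hx ⟨?_, ?_, ?_⟩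
  · exact abs_le.1 (by linarith [hi 0, Real.pi_gt_three])
  · exact abs_le.1 (by linarith [hi 1, Real.pi_gt_three])
  · exact abs_le.1 (by linarith [hi 2])

theorem fourierCoef3_funF3 (h𝒴 : Continuous 𝒴) (hct : 0 < ct)
    (hε' : ε < min 1 ct / 2) (h𝒴0 : ∀ t : ℝ, 2 * ε ≤ t → 𝒴 t = 0) (j : ℤ × ℤ × ℤ)
    (hj : freqVec α₁ α₂ ct j ≠ 0) :
    fourierCoef3 ct (funF3 k α₁ α₂ 𝒴) j =
      basisNorm ct * (1 / (2 * I * ‖freqVec α₁ α₂ ct j‖) *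
        (cutoffIntegral 𝒴 ct (k + ‖freqVec α₁ α₂ ct j‖) -
          cutoffIntegral 𝒴 ct (k - ‖freqVec α₁ α₂ ct j‖))) := by
  have hct' : (ct : ℂ) ≠ 0 := by exact_mod_cast hct.ne'
  have hρ : (‖freqVec α₁ α₂ ct j‖ : ℂ) ≠ 0 := by exact_mod_cast norm_ne_zero_iff.2 hj
  set ρ := ‖freqVec α₁ α₂ ct j‖ with hρdef
  set h : ℝ → ℂ := fun r => Complex.exp (I * k * r) * (𝒴 r : ℂ) with hh
  have hc : Continuous h := by fun_prop
  have hT : ∀ r, ct ≤ r → h r = 0 := fun r hr => by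
    have : 2 * ε ≤ r := by linarith [min_le_right 1 ct]
    simp [hh, h𝒴0 r this]
  unfold fourierCoef3
  have hpt : ∀ x : EuclideanSpace ℝ (Fin 3), funF3 k α₁ α₂ 𝒴 x * fBasis3 ct (-j) x =
      basisNorm ct * (h ‖x‖ / (4 * π * ‖x‖) *
        Complex.exp (-I * (inner ℝ (freqVec α₁ α₂ ct j) x : ℝ))) := by
    intro x
    have hinner : inner ℝ (freqVec α₁ α₂ ct j) x =
        (α₁ + j.1) * x 0 + (α₂ + j.2.1) * x 1 + j.2.2 * (π / ct) * x 2 := by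
      simp [PiLp.inner_apply, Fin.sum_univ_three, freqVec]
      ring
    have hexp : Complex.exp (-I * (inner ℝ (freqVec α₁ α₂ ct j) x : ℝ)) =
        Complex.exp (-Complex.I * (α₁ : ℂ) * (x 0 : ℂ) - Complex.I * (α₂ : ℂ) * (x 1 : ℂ)) *
        Complex.exp (Complex.I * (((-j).1 : ℂ) * (x 0 : ℂ) + ((-j).2.1 : ℂ) * (x 1 : ℂ) +
          ((-j).2.2 : ℂ) * (π : ℂ) * (x 2 : ℂ) / (ct : ℂ))) := by
      rw [hinner, ← Complex.exp_add]
      congr 1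
      simp only [Prod.fst_neg, Prod.snd_neg]
      push_cast
      field_simp
      ring
    rw [hexp, funF3_eq_radial]
    unfold fBasis3 basisNorm
    ring
  simp_rw [hpt]
  rw [integral_const_mul, setIntegral_eq_integral_of_forall_compl_eq_zero,
    integral_radial_mul_cexp hc hct hT hj]
  · congr 1
    rw [← hρdef]
    unfold cutoffIntegral
    rw [← intervalIntegral.integral_sub
      ((by fun_prop : Continuous fun t : ℝ =>
        (𝒴 t : ℂ) * Complex.exp (I * (k + ρ) * t)).intervalIntegrable _ _)
      ((by fun_prop : Continuous fun t : ℝ =>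
        (𝒴 t : ℂ) * Complex.exp (I * (k - ρ) * t)).intervalIntegrable _ _),
      ← intervalIntegral.integral_const_mul, ← intervalIntegral.integral_const_mul]
    congr 1
    ext r
    simp only [hh, Complex.sin]
    rw [show I * (k + ρ) * (r : ℂ) = I * k * r + ρ * r * I by ring,
      show I * (k - ρ) * (r : ℂ) = I * k * r + -(ρ * r) * I by ring, Complex.exp_add,
      Complex.exp_add]
    field_simp
    rw [I_sq]
    ring
  · intro x hx
    simp [hh, h𝒴0 _ (two_mul_le_norm_of_notMem_domDd hε' hx)]

/-- Asymptotics of the Fourier coefficients of the cut-off singularity. -/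
theorem exists_norm_fourierCoef3_funF3_sub_le (p : ℕ) (h𝒴 : ContDiff ℝ (p + 1 : ℕ) 𝒴)
    (hk : 0 < k) (hct : 0 < ct) (hε : 0 < ε) (hε' : ε < min 1 ct / 2)
    (h𝒴1 : ∀ t : ℝ, t ≤ ε → 𝒴 t = 1) (h𝒴0 : ∀ t : ℝ, 2 * ε ≤ t → 𝒴 t = 0) :
    ∃ B : ℝ, 0 ≤ B ∧ ∀ j : ℤ × ℤ × ℤ, k < ‖freqVec α₁ α₂ ct j‖ →
      ‖fourierCoef3 ct (funF3 k α₁ α₂ 𝒴) j -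
          basisNorm ct / ((‖freqVec α₁ α₂ ct j‖ ^ 2 - k ^ 2 : ℝ) : ℂ)‖ ≤
        B / (‖freqVec α₁ α₂ ct j‖ * (‖freqVec α₁ α₂ ct j‖ - k) ^ (p + 1)) := by
  have hεct : 2 * ε < ct := by linarith [min_le_right 1 ct]
  obtain ⟨B, hB0, hB⟩ := exists_norm_integral_cutoff_sub_le p h𝒴 hε (by linarith) hεct
    (fun t ht => h𝒴1 t ((le_abs_self t).trans ht)) h𝒴0
  refine ⟨basisNorm ct * B, mul_nonneg (basisNorm_pos hct).le hB0, fun j hj => ?_⟩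
  set ρ := ‖freqVec α₁ α₂ ct j‖ with hρdef
  have hρ0 : 0 < ρ := hk.trans hj
  have hne : freqVec α₁ α₂ ct j ≠ 0 := norm_ne_zero_iff.1 (by rw [← hρdef]; exact hρ0.ne')
  rw [fourierCoef3_funF3 h𝒴.continuous hct hε' h𝒴0 j hne, ← hρdef]
  have hz1 : ((k + ρ : ℝ) : ℂ) ≠ 0 := by
    have : k + ρ ≠ 0 := by positivity
    exact_mod_cast this
  have hz2 : ((k - ρ : ℝ) : ℂ) ≠ 0 := by
    have : k - ρ ≠ 0 := by linarith
    exact_mod_cast this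
  have h1 := hB ((k + ρ : ℝ) : ℂ) hz1 (by rw [ofReal_im])
  have h2 := hB ((k - ρ : ℝ) : ℂ) hz2 (by rw [ofReal_im])
  rw [ofReal_im, mul_zero, Real.exp_zero, mul_one, Complex.norm_real, Real.norm_eq_abs] at h1 h2
  rw [abs_of_pos (by positivity)] at h1
  rw [abs_of_neg (by linarith), neg_sub] at h2
  change ‖cutoffIntegral 𝒴 ct _ - _‖ ≤ _ at h1
  change ‖cutoffIntegral 𝒴 ct _ - _‖ ≤ _ at h2
  push_cast at h1 h2 hz1 hz2
  have hρC : (ρ : ℂ) ≠ 0 := by exact_mod_cast hρ0.ne'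
  have hz3 : (ρ : ℂ) ^ 2 - (k : ℂ) ^ 2 ≠ 0 := by
    rw [show (ρ : ℂ) ^ 2 - (k : ℂ) ^ 2 = -((k + ρ) * (k - ρ)) by ring]
    exact neg_ne_zero.2 (mul_ne_zero hz1 hz2)
  have key : (basisNorm ct : ℂ) * (1 / (2 * I * ρ) *
        (cutoffIntegral 𝒴 ct (k + ρ) - cutoffIntegral 𝒴 ct (k - ρ))) -
      basisNorm ct / ((ρ ^ 2 - k ^ 2 : ℝ) : ℂ) =
      basisNorm ct * (1 / (2 * I * ρ) * ((cutoffIntegral 𝒴 ct (k + ρ) - I / (k + ρ)) -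
        (cutoffIntegral 𝒴 ct (k - ρ) - I / (k - ρ)))) := by
    have : (1 : ℂ) / ((ρ ^ 2 - k ^ 2 : ℝ) : ℂ) =
        1 / (2 * I * ρ) * (I / (k + ρ) - I / (k - ρ)) := by
      push_cast
      field_simp
      ring
    rw [div_eq_mul_one_div (basisNorm ct : ℂ), this]
    ring
  rw [key, norm_mul, norm_mul, Complex.norm_real, Real.norm_of_nonneg (basisNorm_pos hct).le]
  have hn : ‖(1 : ℂ) / (2 * I * ρ)‖ = 1 / (2 * ρ) := by
    rw [norm_div, norm_mul, norm_mul, norm_I, Complex.norm_real, Real.norm_of_nonneg hρ0.le]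
    simp
  rw [hn]
  have hd : 0 < ρ - k := by linarith
  have h3 : B / (k + ρ) ^ (p + 1) ≤ B / (ρ - k) ^ (p + 1) := by
    gcongr
    linarith
  calc basisNorm ct * (1 / (2 * ρ) * ‖_‖)
      ≤ basisNorm ct * (1 / (2 * ρ) * (B / (ρ - k) ^ (p + 1) + B / (ρ - k) ^ (p + 1))) := by
        have := (basisNorm_pos hct).le
        gcongr
        exact (norm_sub_le _ _).trans (add_le_add (h1.trans h3) h2)
    _ = _ := by
      field_simp
      ring

end Singularity

section HorizontalSeries

open Filter Topology

variable {a : ℤ × ℤ → ℝ → ℂ} {ct : ℝ}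

theorem continuous_sum_mul_wave2 (ha : ∀ n, Continuous (a n)) (s : Finset (ℤ × ℤ)) :
    Continuous fun p : (ℝ × ℝ) × ℝ => ∑ n ∈ s, a n p.2 * wave2 n p.1 :=
  continuous_finsetSum _ fun n _ =>
    ((ha n).comp continuous_snd).mul ((continuous_wave2 n).comp continuous_fst)

theorem integral_norm_sum_mul_wave2_sq (ha : ∀ n, Continuous (a n)) (s : Finset (ℤ × ℤ)) :
    ∫ p in box3 ct, ‖∑ n ∈ s, a n p.2 * wave2 n p.1‖ ^ 2 =
      ∑ n ∈ s, 4 * π ^ 2 * ∫ t in Set.Icc (-ct) ct, ‖a n t‖ ^ 2 := by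
  have hInt : ∀ f : (ℝ × ℝ) × ℝ → ℂ, Continuous f → Integrable f (volume.restrict (box3 ct)) :=
    fun f hf => hf.continuousOn.integrableOn_compact (isCompact_box3 ct)
  have hw := continuous_wave2
  have key : ∀ p : (ℝ × ℝ) × ℝ, ((‖∑ n ∈ s, a n p.2 * wave2 n p.1‖ ^ 2 : ℝ) : ℂ) =
      ∑ n ∈ s, ∑ l ∈ s, wave2 (n - l) p.1 * (a n p.2 * (starRingEnd ℂ) (a l p.2)) := by
    intro p
    rw [ofReal_pow, ← Complex.mul_conj', map_sum, Finset.sum_mul_sum]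
    refine Finset.sum_congr rfl fun n _ => Finset.sum_congr rfl fun l _ => ?_
    rw [map_mul, conj_wave2, sub_eq_add_neg, ← wave2_mul]
    ring
  apply Complex.ofReal_injective
  rw [← integral_complex_ofReal]
  simp_rw [key]
  have hcont : ∀ n l, Continuous fun p : (ℝ × ℝ) × ℝ =>
      wave2 (n - l) p.1 * (a n p.2 * (starRingEnd ℂ) (a l p.2)) := fun n l => by
    refine ((hw _).comp continuous_fst).mul (((ha n).comp continuous_snd).mul
      (continuous_star.comp ((ha l).comp continuous_snd)))
  rw [integral_finsetSum _ fun n _ => integrable_finsetSum _ fun l _ => hInt _ (hcont n l),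
    ofReal_sum]
  refine Finset.sum_congr rfl fun n hn => ?_
  rw [integral_finsetSum _ fun l _ => hInt _ (hcont n l)]
  have h2 : ∀ l, ∫ p in box3 ct, wave2 (n - l) p.1 * (a n p.2 * (starRingEnd ℂ) (a l p.2)) =
      if n = l then ((4 * π ^ 2 * ∫ t in Set.Icc (-ct) ct, ‖a n t‖ ^ 2 : ℝ) : ℂ) else 0 := by
    intro l
    unfold box3
    rw [Measure.volume_eq_prod, setIntegral_prod_mul (fun q => wave2 (n - l) q)
      (fun t => a n t * (starRingEnd ℂ) (a l t)), integral_wave2]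
    by_cases h : n = l
    · subst h
      rw [if_pos (sub_self n), if_pos rfl, ofReal_mul (4 * π ^ 2) (∫ _ in _, _),
        ← integral_complex_ofReal]
      congr 2
      ext t
      rw [Complex.mul_conj', ofReal_pow]
    · rw [if_neg (sub_ne_zero.2 h), if_neg h, zero_mul]
  simp_rw [h2]
  rw [Finset.sum_ite_eq, if_pos hn]

theorem ae_snd_ne_zero : ∀ᵐ p : (ℝ × ℝ) × ℝ, p.2 ≠ 0 := by
  have h : volume (Set.univ ×ˢ ({0} : Set ℝ) : Set ((ℝ × ℝ) × ℝ)) = 0 := by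
    rw [Measure.volume_eq_prod, Measure.prod_prod]
    simp
  rw [ae_iff]
  refine measure_mono_null (fun p hp => ?_) h
  simpa using hp

theorem integrableOn_tsum_mul_wave2 (ha : ∀ n, Continuous (a n))
    (hsum : ∀ t, t ≠ 0 → Summable fun n => ‖a n t‖) {M : ℤ × ℤ → ℝ} (hM : Summable M)
    (haM : ∀ n, ∫ t in Set.Icc (-ct) ct, ‖a n t‖ ^ 2 ≤ M n) :
    IntegrableOn (fun p : (ℝ × ℝ) × ℝ => ∑' n, a n p.2 * wave2 n p.1) (box3 ct) := by
  have hInt : ∀ f : (ℝ × ℝ) × ℝ → ℝ, Continuous f → Integrable f (volume.restrict (box3 ct)) :=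
    fun f hf => hf.continuousOn.integrableOn_compact (isCompact_box3 ct)
  have hS := fun s => continuous_sum_mul_wave2 ha s
  have hM0 : ∀ n, 0 ≤ M n := fun n =>
    (integral_nonneg fun t => sq_nonneg ‖a n t‖).trans (haM n)
  have hlim : ∀ᵐ p ∂(volume.restrict (box3 ct)), Tendsto
      (fun s : Finset (ℤ × ℤ) => ∑ n ∈ s, a n p.2 * wave2 n p.1) atTop
      (𝓝 (∑' n, a n p.2 * wave2 n p.1)) := by
    filter_upwards [ae_restrict_of_ae ae_snd_ne_zero] with p hp
    refine Summable.hasSum (Summable.of_norm ?_)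
    simpa [norm_wave2] using hsum p.2 hp
  refine ⟨aestronglyMeasurable_of_tendsto_ae atTop (fun s => (hS s).aestronglyMeasurable) hlim, ?_⟩
  set R : ℝ := ∫ p in box3 ct, (1 : ℝ) with hR
  have hbound : ∀ s : Finset (ℤ × ℤ), ∫⁻ p in box3 ct, ‖∑ n ∈ s, a n p.2 * wave2 n p.1‖ₑ ≤
      ENNReal.ofReal (R + 4 * π ^ 2 * ∑' n, M n) := by
    intro s
    have hcn := (hS s).norm
    rw [← ofReal_integral_norm_eq_lintegral_enorm
      ((hS s).continuousOn.integrableOn_compact (isCompact_box3 ct))]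
    refine ENNReal.ofReal_le_ofReal ?_
    calc ∫ p in box3 ct, ‖∑ n ∈ s, a n p.2 * wave2 n p.1‖
        ≤ ∫ p in box3 ct, (1 + ‖∑ n ∈ s, a n p.2 * wave2 n p.1‖ ^ 2) :=
          integral_mono (hInt _ hcn) (hInt _ (by fun_prop)) fun p => by
            dsimp only
            nlinarith [sq_nonneg (‖∑ n ∈ s, a n p.2 * wave2 n p.1‖ - 1)]
      _ = R + ∑ n ∈ s, 4 * π ^ 2 * ∫ t in Set.Icc (-ct) ct, ‖a n t‖ ^ 2 := by
          rw [integral_add (hInt _ (by fun_prop)) (hInt _ (by fun_prop)),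
            integral_norm_sum_mul_wave2_sq ha]
      _ ≤ R + 4 * π ^ 2 * ∑' n, M n := by
          rw [← Finset.mul_sum]
          gcongr
          exact (Finset.sum_le_sum fun n _ => haM n).trans (hM.sum_le_tsum s fun n _ => hM0 n)
  calc ∫⁻ p in box3 ct, ‖∑' n, a n p.2 * wave2 n p.1‖ₑ
      = ∫⁻ p in box3 ct, liminf (fun s : Finset (ℤ × ℤ) => ‖∑ n ∈ s, a n p.2 * wave2 n p.1‖ₑ)
          atTop := by
        refine lintegral_congr_ae ?_
        filter_upwards [hlim] with p hp
        exact (hp.enorm.liminf_eq).symm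
    _ ≤ liminf (fun s : Finset (ℤ × ℤ) => ∫⁻ p in box3 ct, ‖∑ n ∈ s, a n p.2 * wave2 n p.1‖ₑ)
          atTop := lintegral_liminf_le fun s => (hS s).enorm.measurable
    _ ≤ ENNReal.ofReal (R + 4 * π ^ 2 * ∑' n, M n) :=
        (liminf_le_liminf (Eventually.of_forall hbound)).trans_eq (liminf_const _)
    _ < ⊤ := ENNReal.ofReal_lt_top

theorem integral_tsum_mul_wave2_mul_wave3 (hsum : ∀ t, t ≠ 0 → Summable fun n => ‖a n t‖)
    (hInt : IntegrableOn (fun p : (ℝ × ℝ) × ℝ => ∑' n, a n p.2 * wave2 n p.1) (box3 ct))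
    (j : ℤ × ℤ × ℤ) :
    ∫ p in box3 ct, (∑' n, a n p.2 * wave2 n p.1) * wave3 ct (-j) p =
      4 * π ^ 2 * ∫ t in Set.Icc (-ct) ct,
        a (j.1, j.2.1) t * Complex.exp (-(I * (j.2.2 * (π / ct) : ℝ) * t)) := by
  have hInt2 : Integrable (fun p : (ℝ × ℝ) × ℝ =>
      (∑' n, a n p.2 * wave2 n p.1) * wave3 ct (-j) p)
      ((volume.restrict cell2).prod (volume.restrict (Set.Icc (-ct) ct))) := by
    rw [Measure.prod_restrict, ← Measure.volume_eq_prod]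
    exact hInt.mul_bdd (c := 1) (continuous_wave3 ct (-j)).aestronglyMeasurable
      (Eventually.of_forall fun p => (norm_wave3 ct (-j) p).le)
  have hcell : ∀ f : ℝ × ℝ → ℂ, Continuous f → Integrable f (volume.restrict cell2) :=
    fun f hf => hf.continuousOn.integrableOn_compact isCompact_cell2
  have h0 : ∫ p in box3 ct, (∑' n, a n p.2 * wave2 n p.1) * wave3 ct (-j) p =
      ∫ t in Set.Icc (-ct) ct, ∫ q in cell2, (∑' n, a n t * wave2 n q) * wave3 ct (-j) (q, t) := by
    rw [← integral_prod_symm _ hInt2, Measure.prod_restrict, ← Measure.volume_eq_prod, box3]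
  rw [h0, ← integral_const_mul]
  refine integral_congr_ae (ae_restrict_of_ae ?_)
  have hne : ∀ᵐ t : ℝ, t ≠ 0 := by
    rw [ae_iff]
    simp
  filter_upwards [hne] with t ht
  set e : ℂ := Complex.exp (-(I * (j.2.2 * (π / ct) : ℝ) * t)) with he
  have h1 : ∀ q, (∑' n, a n t * wave2 n q) * wave3 ct (-j) (q, t) =
      ∑' n, a n t * e * wave2 (n - (j.1, j.2.1)) q := by
    intro q
    rw [← tsum_mul_right]
    refine tsum_congr fun n => ?_
    rw [sub_eq_add_neg, ← wave2_mul, wave3, he]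
    have : Complex.exp (I * ((((-j).2.2 : ℤ) : ℝ) * (π / ct) : ℝ) * t) =
        Complex.exp (-(I * (j.2.2 * (π / ct) : ℝ) * t)) := by
      congr 1
      simp
    rw [this]
    have h2 : ((-j).1, (-j).2.1) = -(j.1, j.2.1) := rfl
    rw [h2]
    ring
  simp_rw [h1]
  have he1 : ‖e‖ = 1 := by
    rw [he, ← mul_neg, ← ofReal_neg, norm_cexp_I_mul_ofReal_mul]
  have hnorm : ∀ n, ∫ q in cell2, ‖a n t * e * wave2 (n - (j.1, j.2.1)) q‖ =
      (∫ q in cell2, (1 : ℝ)) * ‖a n t‖ := by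
    intro n
    rw [← integral_mul_const]
    refine integral_congr_ae (Eventually.of_forall fun q => ?_)
    simp [norm_wave2, he1]
  rw [← integral_tsum_of_summable_integral_norm
    (F := fun n q => a n t * e * wave2 (n - (j.1, j.2.1)) q)
    (fun n => hcell _ (continuous_const.mul (continuous_wave2 _)))
    (by simp_rw [hnorm]; exact (hsum t ht).mul_left _)]
  have h3 : ∀ n, ∫ q in cell2, a n t * e * wave2 (n - (j.1, j.2.1)) q =
      if n = (j.1, j.2.1) then a n t * e * (4 * π ^ 2 : ℝ) else 0 := by
    intro n
    rw [integral_const_mul, integral_wave2]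
    by_cases h : n = (j.1, j.2.1)
    · rw [if_pos h, if_pos (by rw [h, sub_self])]
    · rw [if_neg h, if_neg (sub_ne_zero.2 h), mul_zero]
  simp_rw [h3]
  rw [tsum_ite_eq]
  push_cast
  ring

theorem continuousOn_tsum_mul_wave2 (ha : ∀ n, Continuous (a n))
    (hsum : ∀ δ > 0, ∃ u : ℤ × ℤ → ℝ, Summable u ∧ ∀ n t, δ < |t| → ‖a n t‖ ≤ u n) :
    ContinuousOn (fun p : (ℝ × ℝ) × ℝ => ∑' n, a n p.2 * wave2 n p.1) {p | p.2 ≠ 0} := by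
  intro p hp
  have hp' : 0 < |p.2| := abs_pos.2 hp
  obtain ⟨u, hu, hau⟩ := hsum (|p.2| / 2) (by positivity)
  have hc : ContinuousOn (fun p : (ℝ × ℝ) × ℝ => ∑' n, a n p.2 * wave2 n p.1)
      {q | |p.2| / 2 < |q.2|} := by
    refine continuousOn_tsum (fun n => (((ha n).comp continuous_snd).mul
      ((continuous_wave2 n).comp continuous_fst)).continuousOn) hu fun n q hq => ?_
    simpa [norm_wave2] using hau n q.2 hq
  refine (hc.continuousAt ?_).continuousWithinAt
  exact (isOpen_lt continuous_const continuous_snd.abs).mem_nhds (by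
    change |p.2| / 2 < |p.2|
    linarith)

end HorizontalSeries

/-- The vertical profile of the mode `n` of the truncated Green's function. -/
def verticalCoef (k α₁ α₂ : ℝ) (𝒳 : ℝ → ℝ) (n : ℤ × ℤ) (t : ℝ) : ℂ :=
  I / (8 * π ^ 2) * (1 / betaCoef3 k α₁ α₂ n) *
    (Complex.exp (I * betaCoef3 k α₁ α₂ n * (|t| : ℝ)) * (𝒳 |t| : ℂ))

section TruncatedGreen

variable {k α₁ α₂ b c ct : ℝ} {𝒳 : ℝ → ℝ}

theorem funKd_ofProd (p : (ℝ × ℝ) × ℝ) :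
    funKd k α₁ α₂ 𝒳 (ofProd p) = ∑' n, verticalCoef k α₁ α₂ 𝒳 n p.2 * wave2 n p.1 := by
  have h0 : (ofProd p) 0 = p.1.1 := rfl
  have h1 : (ofProd p) 1 = p.1.2 := rfl
  have h2 : (ofProd p) 2 = p.2 := rfl
  rw [funKd, greenGd, h0, h1, h2, ← tsum_mul_left, ← tsum_mul_left, ← tsum_mul_right]
  refine tsum_congr fun n => ?_
  set β := betaCoef3 k α₁ α₂ n
  have h : Complex.exp (-I * α₁ * p.1.1 - I * α₂ * p.1.2) *
      Complex.exp (I * ((α₁ + (n.1 : ℝ) : ℝ) : ℂ) * p.1.1 +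
        I * ((α₂ + (n.2 : ℝ) : ℝ) : ℂ) * p.1.2 + I * β * (|p.2| : ℝ)) =
      Complex.exp (I * β * (|p.2| : ℝ)) * wave2 n p.1 := by
    rw [wave2, ← Complex.exp_add, ← Complex.exp_add, ← Complex.exp_add]
    congr 1
    push_cast
    ring
  calc _ = I / (8 * π ^ 2) * (1 / β) * (𝒳 |p.2| : ℂ) *
        (Complex.exp (-I * α₁ * p.1.1 - I * α₂ * p.1.2) *
          Complex.exp (I * ((α₁ + (n.1 : ℝ) : ℝ) : ℂ) * p.1.1 +
            I * ((α₂ + (n.2 : ℝ) : ℝ) : ℂ) * p.1.2 + I * β * (|p.2| : ℝ))) := by ring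
    _ = _ := by
      rw [h, verticalCoef]
      ring

theorem continuous_verticalCoef (h𝒳 : Continuous 𝒳) (n : ℤ × ℤ) :
    Continuous (verticalCoef k α₁ α₂ 𝒳 n) := by
  unfold verticalCoef
  fun_prop

theorem norm_cexp_I_mul_betaCoef3_mul_le (hk : 0 < k) (n : ℤ × ℤ) {t : ℝ} (ht : 0 ≤ t) :
    ‖Complex.exp (I * betaCoef3 k α₁ α₂ n * t)‖ ≤
      Real.exp (k * t) * Real.exp (-t * ‖betaCoef3 k α₁ α₂ n‖) := by
  have h := norm_betaCoef3_sub_le_im k α₁ α₂ hk n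
  rw [Complex.norm_exp, ← Real.exp_add, Real.exp_le_exp]
  have : (I * betaCoef3 k α₁ α₂ n * (t : ℂ)).re = -(t * (betaCoef3 k α₁ α₂ n).im) := by
    simp [mul_comm]
  rw [this]
  nlinarith

theorem exists_norm_verticalCoef_le (hk : 0 < k) (h𝒳 : Continuous 𝒳)
    (h𝒳0 : ∀ t : ℝ, ct ≤ |t| → 𝒳 t = 0) :
    ∃ A : ℝ, 0 ≤ A ∧ ∀ n t, ‖verticalCoef k α₁ α₂ 𝒳 n t‖ ≤
      A / ‖betaCoef3 k α₁ α₂ n‖ * Real.exp (-|t| * ‖betaCoef3 k α₁ α₂ n‖) := by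
  obtain ⟨X, hX⟩ := (isCompact_Icc (a := (0 : ℝ)) (b := ct)).exists_bound_of_continuousOn
    h𝒳.continuousOn
  refine ⟨1 / (8 * π ^ 2) * (|X| * Real.exp (k * ct)), by positivity, fun n t => ?_⟩
  by_cases ht : |t| ≤ ct
  · rw [verticalCoef, norm_mul, norm_mul, norm_mul, norm_div, norm_div, norm_I, norm_one,
      Complex.norm_real]
    have h8 : ‖(8 * (π : ℂ) ^ 2)‖ = 8 * π ^ 2 := by
      simp [abs_of_pos Real.pi_pos]
    rw [h8]
    have h1 := norm_cexp_I_mul_betaCoef3_mul_le (α₁ := α₁) (α₂ := α₂) hk n (abs_nonneg t)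
    have h2 : ‖𝒳 |t|‖ ≤ |X| := (hX |t| ⟨abs_nonneg t, ht⟩).trans (le_abs_self X)
    calc 1 / (8 * π ^ 2) * (1 / ‖betaCoef3 k α₁ α₂ n‖) * (_ * ‖𝒳 |t|‖)
        ≤ 1 / (8 * π ^ 2) * (1 / ‖betaCoef3 k α₁ α₂ n‖) *
          ((Real.exp (k * |t|) * Real.exp (-|t| * ‖betaCoef3 k α₁ α₂ n‖)) * |X|) := by gcongr
      _ ≤ 1 / (8 * π ^ 2) * (1 / ‖betaCoef3 k α₁ α₂ n‖) *
          ((Real.exp (k * ct) * Real.exp (-|t| * ‖betaCoef3 k α₁ α₂ n‖)) * |X|) := by gcongr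
      _ = _ := by ring
  · have h : 𝒳 |t| = 0 := h𝒳0 _ (by rw [abs_abs]; linarith)
    rw [verticalCoef, h, ofReal_zero, mul_zero, mul_zero, norm_zero]
    positivity

theorem exists_summable_norm_verticalCoef_le (hk : 0 < k) (hb : 0 < b)
    (hβ : ∀ n : ℤ × ℤ, b ≤ ‖betaCoef3 k α₁ α₂ n‖) (h𝒳 : Continuous 𝒳)
    (h𝒳0 : ∀ t : ℝ, ct ≤ |t| → 𝒳 t = 0) :
    ∀ δ > 0, ∃ u : ℤ × ℤ → ℝ, Summable u ∧
      ∀ n t, δ < |t| → ‖verticalCoef k α₁ α₂ 𝒳 n t‖ ≤ u n := by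
  intro δ hδ
  obtain ⟨c₀, hc₀, hβ'⟩ := exists_le_norm_betaCoef3 k α₁ α₂ hk hb hβ
  obtain ⟨C, hC, hexp⟩ := exists_exp_neg_norm_betaCoef3_le k α₁ α₂ hc₀ hβ' hδ
  obtain ⟨A, hA0, hA⟩ := exists_norm_verticalCoef_le (α₁ := α₁) (α₂ := α₂) hk h𝒳 h𝒳0
  refine ⟨fun n => A / b * (C * (intWeight n.1 * intWeight n.2)),
    (summable_intWeight_prod.mul_left _).mul_left _, fun n t ht => ?_⟩
  calc _ ≤ A / ‖betaCoef3 k α₁ α₂ n‖ * Real.exp (-|t| * ‖betaCoef3 k α₁ α₂ n‖) := hA n t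
    _ ≤ A / b * Real.exp (-δ * ‖betaCoef3 k α₁ α₂ n‖) := by
      have := hβ n
      gcongr
    _ ≤ _ := mul_le_mul_of_nonneg_left (hexp n) (by positivity)

theorem summable_norm_verticalCoef (hk : 0 < k) (hb : 0 < b)
    (hβ : ∀ n : ℤ × ℤ, b ≤ ‖betaCoef3 k α₁ α₂ n‖) (h𝒳 : Continuous 𝒳)
    (h𝒳0 : ∀ t : ℝ, ct ≤ |t| → 𝒳 t = 0) (t : ℝ) (ht : t ≠ 0) :
    Summable fun n => ‖verticalCoef k α₁ α₂ 𝒳 n t‖ := by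
  have ht' := abs_pos.2 ht
  obtain ⟨u, hu, h⟩ := exists_summable_norm_verticalCoef_le hk hb hβ h𝒳 h𝒳0 (|t| / 2)
    (by positivity)
  exact Summable.of_nonneg_of_le (fun n => norm_nonneg _) (fun n => h n t (by linarith)) hu

theorem continuousOn_funKd_ofProd (hk : 0 < k) (hb : 0 < b)
    (hβ : ∀ n : ℤ × ℤ, b ≤ ‖betaCoef3 k α₁ α₂ n‖) (h𝒳 : Continuous 𝒳)
    (h𝒳0 : ∀ t : ℝ, ct ≤ |t| → 𝒳 t = 0) :
    ContinuousOn (fun p => funKd k α₁ α₂ 𝒳 (ofProd p)) {p | p.2 ≠ 0} := by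
  simp_rw [funKd_ofProd]
  exact continuousOn_tsum_mul_wave2 (continuous_verticalCoef h𝒳)
    (exists_summable_norm_verticalCoef_le hk hb hβ h𝒳 h𝒳0)

theorem setIntegral_exp_neg_abs_mul_le {B : ℝ} (hB : 0 < B) (s : Set ℝ) :
    ∫ t in s, Real.exp (-|t| * B) ≤ 2 / B := by
  have h : ∫ t : ℝ, Real.exp (-|t| * B) = 2 / B := by
    rw [integral_comp_abs (f := fun t => Real.exp (-t * B))]
    have : ∀ t : ℝ, -t * B = -B * t := fun t => by ring
    simp_rw [this]
    rw [integral_exp_mul_Ioi (neg_lt_zero.2 hB) 0]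
    simp
    ring
  have hI : Integrable fun t : ℝ => Real.exp (-|t| * B) :=
    Integrable.of_integral_ne_zero (by rw [h]; positivity)
  exact h ▸ setIntegral_le_integral hI (Filter.Eventually.of_forall fun t => (Real.exp_pos _).le)

theorem integrableOn_funKd_ofProd (hk : 0 < k) (hb : 0 < b)
    (hβ : ∀ n : ℤ × ℤ, b ≤ ‖betaCoef3 k α₁ α₂ n‖) (h𝒳 : Continuous 𝒳)
    (h𝒳0 : ∀ t : ℝ, ct ≤ |t| → 𝒳 t = 0) :
    IntegrableOn (fun p => funKd k α₁ α₂ 𝒳 (ofProd p)) (box3 ct) := by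
  simp_rw [funKd_ofProd]
  obtain ⟨c₀, hc₀, hβ'⟩ := exists_le_norm_betaCoef3 k α₁ α₂ hk hb hβ
  obtain ⟨A, hA0, hA⟩ := exists_norm_verticalCoef_le (α₁ := α₁) (α₂ := α₂) hk h𝒳 h𝒳0
  refine integrableOn_tsum_mul_wave2 (continuous_verticalCoef h𝒳)
    (summable_norm_verticalCoef hk hb hβ h𝒳 h𝒳0)
    (summable_intWeight_prod.mul_left (A ^ 2 * (c₀ ^ 3)⁻¹)) fun n => ?_
  have hβ0 : 0 < ‖betaCoef3 k α₁ α₂ n‖ := hb.trans_le (hβ n)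
  set B := ‖betaCoef3 k α₁ α₂ n‖ with hBdef
  calc ∫ t in Set.Icc (-ct) ct, ‖verticalCoef k α₁ α₂ 𝒳 n t‖ ^ 2
      ≤ ∫ t in Set.Icc (-ct) ct, A ^ 2 / B ^ 2 * Real.exp (-|t| * (2 * B)) := by
        have hc := continuous_verticalCoef (k := k) (α₁ := α₁) (α₂ := α₂) h𝒳 n
        refine integral_mono
          ((by fun_prop : Continuous fun t => ‖verticalCoef k α₁ α₂ 𝒳 n t‖ ^ 2).continuousOn
            |>.integrableOn_compact isCompact_Icc)
          ((by fun_prop : Continuous fun t : ℝ => A ^ 2 / B ^ 2 *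
            Real.exp (-|t| * (2 * B))).continuousOn.integrableOn_compact isCompact_Icc)
          fun t => ?_
        have h := pow_le_pow_left₀ (norm_nonneg _) (hA n t) 2
        refine h.trans_eq ?_
        rw [mul_pow, div_pow, ← Real.exp_nat_mul]
        congr 2
        push_cast
        ring
    _ ≤ A ^ 2 / B ^ 2 * (2 / (2 * B)) := by
        rw [integral_const_mul]
        gcongr
        exact setIntegral_exp_neg_abs_mul_le (by positivity) _
    _ = A ^ 2 * (B ^ 3)⁻¹ := by field_simp
    _ ≤ A ^ 2 * ((c₀ * (1 + |(n.1 : ℝ)| + |(n.2 : ℝ)|)) ^ 3)⁻¹ := by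
        gcongr
        exact hβ' n
    _ ≤ _ := by
        rw [mul_pow, mul_inv, mul_assoc]
        gcongr
        exact inv_pow_le_intWeight_prod n

theorem fourierCoef3_funKd (hk : 0 < k) (hb : 0 < b) (hct : 0 < ct)
    (hβ : ∀ n : ℤ × ℤ, b ≤ ‖betaCoef3 k α₁ α₂ n‖) (h𝒳 : Continuous 𝒳)
    (h𝒳0 : ∀ t : ℝ, ct ≤ |t| → 𝒳 t = 0) (j : ℤ × ℤ × ℤ) :
    fourierCoef3 ct (funKd k α₁ α₂ 𝒳) j =
      basisNorm ct * (I / (2 * betaCoef3 k α₁ α₂ (j.1, j.2.1)) *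
        (cutoffIntegral 𝒳 ct (betaCoef3 k α₁ α₂ (j.1, j.2.1) + (j.2.2 * (π / ct) : ℝ)) +
          cutoffIntegral 𝒳 ct (betaCoef3 k α₁ α₂ (j.1, j.2.1) - (j.2.2 * (π / ct) : ℝ)))) := by
  have h1 : fourierCoef3 ct (funKd k α₁ α₂ 𝒳) j = basisNorm ct * ∫ p in box3 ct,
      (∑' n, verticalCoef k α₁ α₂ 𝒳 n p.2 * wave2 n p.1) * wave3 ct (-j) p := by
    rw [fourierCoef3, setIntegral_domDd, ← integral_const_mul]
    refine integral_congr_ae (Filter.Eventually.of_forall fun p => ?_)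
    dsimp only
    rw [funKd_ofProd, fBasis3_ofProd, basisNorm]
    ring
  have hInt := integrableOn_funKd_ofProd hk hb hβ h𝒳 h𝒳0
  simp_rw [funKd_ofProd] at hInt
  rw [h1, integral_tsum_mul_wave2_mul_wave3 (summable_norm_verticalCoef hk hb hβ h𝒳 h𝒳0) hInt]
  congr 1
  set β := betaCoef3 k α₁ α₂ (j.1, j.2.1) with hβdef
  set η : ℝ := j.2.2 * (π / ct) with hη
  have hβ0 : β ≠ 0 := norm_pos_iff.1 (hb.trans_le (hβ _))
  have hcont : Continuous fun t : ℝ =>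
      verticalCoef k α₁ α₂ 𝒳 (j.1, j.2.1) t * Complex.exp (-(I * η * t)) :=
    (continuous_verticalCoef h𝒳 _).mul (by fun_prop)
  have hcut : ∀ z : ℂ, IntervalIntegrable
      (fun t : ℝ => (𝒳 t : ℂ) * Complex.exp (I * z * t)) volume 0 ct := fun z =>
    (by fun_prop : Continuous fun t : ℝ => (𝒳 t : ℂ) * Complex.exp (I * z * t)).intervalIntegrable
      _ _
  rw [integral_Icc_eq_integral_Ioc, ← intervalIntegral.integral_of_le (by linarith),
    integral_neg_self_eq_integral_add (hcont.intervalIntegrable _ _)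
      (hcont.intervalIntegrable _ _), cutoffIntegral, cutoffIntegral,
    ← intervalIntegral.integral_add (hcut _) (hcut _), ← intervalIntegral.integral_const_mul,
    ← intervalIntegral.integral_const_mul]
  refine intervalIntegral.integral_congr fun t ht => ?_
  rw [Set.uIcc_of_le hct.le] at ht
  have e1 : Complex.exp (I * (β + η) * t) = Complex.exp (I * β * t) * Complex.exp (I * η * t) := by
    rw [← Complex.exp_add]
    ring_nf
  have e2 : Complex.exp (I * (β - η) * t) =
      Complex.exp (I * β * t) * Complex.exp (-(I * η * t)) := by
    rw [← Complex.exp_add]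
    ring_nf
  have e3 : -(I * (η : ℂ) * ((-t : ℝ) : ℂ)) = I * η * t := by
    push_cast
    ring
  have hpi : (π : ℂ) ≠ 0 := by exact_mod_cast Real.pi_ne_zero
  rw [e1, e2, e3, verticalCoef, verticalCoef, abs_neg, abs_of_nonneg ht.1]
  rw [← hβdef]
  field_simp
  ring

theorem exists_norm_fourierCoef3_funKd_sub_le (p : ℕ) (h𝒳 : ContDiff ℝ (p + 1 : ℕ) 𝒳)
    (hk : 0 < k) (hb : 0 < b) (hc : 0 < c) (hcct : c < ct)
    (hβ : ∀ n : ℤ × ℤ, b ≤ ‖betaCoef3 k α₁ α₂ n‖)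
    (h𝒳1 : ∀ t : ℝ, |t| ≤ c → 𝒳 t = 1) (h𝒳0 : ∀ t : ℝ, (c + ct) / 2 ≤ |t| → 𝒳 t = 0) :
    ∃ B : ℝ, 0 ≤ B ∧ ∀ (j : ℤ × ℤ × ℤ) (r : ℝ), 0 < r →
      r ≤ ‖betaCoef3 k α₁ α₂ (j.1, j.2.1) + (j.2.2 * (π / ct) : ℝ)‖ →
      r ≤ ‖betaCoef3 k α₁ α₂ (j.1, j.2.1) - (j.2.2 * (π / ct) : ℝ)‖ →
      ‖fourierCoef3 ct (funKd k α₁ α₂ 𝒳) j -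
          basisNorm ct / ((‖freqVec α₁ α₂ ct j‖ ^ 2 - k ^ 2 : ℝ) : ℂ)‖ ≤
        B * Real.exp (-c * ‖betaCoef3 k α₁ α₂ (j.1, j.2.1)‖) / r ^ (p + 1) := by
  have hct : 0 < ct := hc.trans hcct
  obtain ⟨B, hB0, hB⟩ := exists_norm_integral_cutoff_sub_le p h𝒳 hc (T' := (c + ct) / 2)
    (T := ct) (by linarith) (by linarith) h𝒳1 (fun t ht => h𝒳0 t (ht.trans (le_abs_self t)))
  have hκ := basisNorm_pos hct
  refine ⟨basisNorm ct * (1 / b * (B * Real.exp (c * k))), by positivity, fun j r hr h1 h2 => ?_⟩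
  rw [fourierCoef3_funKd hk hb hct hβ h𝒳.continuous (fun t ht => h𝒳0 t (by linarith))]
  obtain ⟨him, -, hsq⟩ := betaCoef3_cases k α₁ α₂ hk (j.1, j.2.1)
  have him' := norm_betaCoef3_sub_le_im k α₁ α₂ hk (j.1, j.2.1)
  have hb' := hβ (j.1, j.2.1)
  have hρ := norm_freqVec_sq α₁ α₂ ct j
  set β := betaCoef3 k α₁ α₂ (j.1, j.2.1)
  set η : ℝ := j.2.2 * (π / ct)
  have hβ0 : β ≠ 0 := norm_pos_iff.1 (hb.trans_le hb')
  have hz1 : β + η ≠ 0 := norm_pos_iff.1 (hr.trans_le h1)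
  have hz2 : β - η ≠ 0 := norm_pos_iff.1 (hr.trans_le h2)
  have bound : ∀ z : ℂ, z ≠ 0 → z.im = β.im → r ≤ ‖z‖ → ‖cutoffIntegral 𝒳 ct z - I / z‖ ≤
      B * Real.exp (c * k) * Real.exp (-c * ‖β‖) / r ^ (p + 1) := by
    intro z hz hzim hrz
    refine (hB z hz (hzim ▸ him)).trans ?_
    rw [mul_assoc, ← Real.exp_add, hzim]
    gcongr
    nlinarith
  have b1 := bound _ hz1 (by simp) h1
  have b2 := bound _ hz2 (by simp) h2
  have hmain : (1 : ℂ) / ((‖freqVec α₁ α₂ ct j‖ ^ 2 - k ^ 2 : ℝ) : ℂ) =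
      I / (2 * β) * (I / (β + η) + I / (β - η)) := by
    have h3 : ((‖freqVec α₁ α₂ ct j‖ ^ 2 - k ^ 2 : ℝ) : ℂ) = -((β + η) * (β - η)) := by
      have : (β + η) * (β - η) = β ^ 2 - η ^ 2 := by ring
      rw [this, hsq, hρ]
      push_cast
      ring
    rw [h3]
    field_simp
    rw [I_sq]
    ring
  have key : (basisNorm ct : ℂ) * (I / (2 * β) *
        (cutoffIntegral 𝒳 ct (β + η) + cutoffIntegral 𝒳 ct (β - η))) -
      basisNorm ct / ((‖freqVec α₁ α₂ ct j‖ ^ 2 - k ^ 2 : ℝ) : ℂ) =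
      basisNorm ct * (I / (2 * β) * ((cutoffIntegral 𝒳 ct (β + η) - I / (β + η)) +
        (cutoffIntegral 𝒳 ct (β - η) - I / (β - η)))) := by
    rw [div_eq_mul_one_div (basisNorm ct : ℂ), hmain]
    ring
  rw [key, norm_mul, norm_mul, Complex.norm_real, Real.norm_of_nonneg hκ.le]
  have hn : ‖I / (2 * β)‖ ≤ 1 / (2 * b) := by
    rw [norm_div, norm_mul, norm_I]
    simp only [Complex.norm_ofNat]
    gcongr
  calc basisNorm ct * (‖I / (2 * β)‖ * ‖_‖)
      ≤ basisNorm ct * (1 / (2 * b) * (B * Real.exp (c * k) * Real.exp (-c * ‖β‖) / r ^ (p + 1) +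
          B * Real.exp (c * k) * Real.exp (-c * ‖β‖) / r ^ (p + 1))) := by
        gcongr
        exact (norm_add_le _ _).trans (add_le_add b1 b2)
    _ = _ := by
      field_simp
      ring

end TruncatedGreen

section UniformConvergence

open Filter Topology

theorem closure_interior_box3 {ct : ℝ} (hct : 0 < ct) : closure (interior (box3 ct)) = box3 ct := by
  rw [interior_box3, closure_prod_eq, closure_prod_eq, closure_Ioo (by linarith [Real.pi_pos]),
    closure_Ioo (by linarith)]
  rfl

theorem basisNorm_sq_mul {ct : ℝ} (hct : 0 < ct) :
    (basisNorm ct : ℂ) * basisNorm ct * ((8 * π ^ 2 * ct : ℝ) : ℂ) = 1 := by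
  have : basisNorm ct * basisNorm ct * (8 * π ^ 2 * ct) = 1 := by
    rw [basisNorm, ← sq, div_pow, Real.sq_sqrt (by positivity)]
    field_simp
  exact_mod_cast this

theorem one_le_index_size (j : ℤ × ℤ × ℤ) :
    1 ≤ 1 + |(j.1 : ℝ)| + |(j.2.1 : ℝ)| + |(j.2.2 : ℝ)| := by
  have h1 := abs_nonneg (j.1 : ℝ)
  have h2 := abs_nonneg (j.2.1 : ℝ)
  have h3 := abs_nonneg (j.2.2 : ℝ)
  linarith

theorem le_index_size_of_notMem_cubeIdx {N : ℕ} {j : ℤ × ℤ × ℤ} (hj : j ∉ cubeIdx N) :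
    (N : ℝ) ≤ 1 + |(j.1 : ℝ)| + |(j.2.1 : ℝ)| + |(j.2.2 : ℝ)| := by
  have h : (N : ℤ) ≤ 1 + |j.1| + |j.2.1| + |j.2.2| := by
    by_contra! h
    have h1 := abs_nonneg j.1
    have h2 := abs_nonneg j.2.1
    have h3 := abs_nonneg j.2.2
    refine hj ?_
    simp only [cubeIdx, Finset.mem_product, Finset.mem_Icc]
    have a1 := abs_le.1 (le_refl |j.1|)
    have a2 := abs_le.1 (le_refl |j.2.1|)
    have a3 := abs_le.1 (le_refl |j.2.2|)
    omega
  exact_mod_cast h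

/-- A function with absolutely summable Fourier coefficients equals its Fourier series wherever
it is continuous off the plane `p.2 = 0`. -/
theorem eqOn_tsum_wave3 {ct : ℝ} (hct : 0 < ct) {g : (ℝ × ℝ) × ℝ → ℂ}
    (hg : IntegrableOn g (box3 ct)) (hgc : ContinuousOn g {p | p.2 ≠ 0})
    {a : ℤ × ℤ × ℤ → ℂ}
    (ha : ∀ j, a j = basisNorm ct * ∫ p in box3 ct, g p * wave3 ct (-j) p)
    (hsum : Summable fun j => ‖a j‖) :
    Set.EqOn g (fun p => ∑' j, a j * (basisNorm ct * wave3 ct j p)) (box3 ct ∩ {p | p.2 ≠ 0}) := by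
  have hκ := basisNorm_pos hct
  have hterm : ∀ j p, ‖a j * (basisNorm ct * wave3 ct j p)‖ = ‖a j‖ * basisNorm ct := by
    intro j p
    rw [norm_mul, norm_mul, norm_wave3, Complex.norm_real, Real.norm_of_nonneg hκ.le, mul_one]
  set M : (ℝ × ℝ) × ℝ → ℂ := fun p => ∑' j, a j * (basisNorm ct * wave3 ct j p) with hM
  have hMc : Continuous M := continuous_tsum
    (fun j => continuous_const.mul (continuous_const.mul (continuous_wave3 ct j)))
    (hsum.mul_right (basisNorm ct)) fun j p => (hterm j p).le
  have hMi : IntegrableOn M (box3 ct) := hMc.continuousOn.integrableOn_compact (isCompact_box3 ct)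
  have hwave : ∀ (f : (ℝ × ℝ) × ℝ → ℂ) (i : ℤ × ℤ × ℤ), IntegrableOn f (box3 ct) →
      IntegrableOn (fun p => wave3 ct i p * f p) (box3 ct) := fun f i hf =>
    hf.bdd_mul (c := 1) (continuous_wave3 ct i).aestronglyMeasurable
      (Eventually.of_forall fun p => (norm_wave3 ct i p).le)
  have hMint : ∀ i, ∫ p in box3 ct, wave3 ct i p * M p =
      a (-i) * (basisNorm ct * ((8 * π ^ 2 * ct : ℝ) : ℂ)) := by
    intro i
    have h1 : ∀ p, wave3 ct i p * M p = ∑' j, a j * basisNorm ct * wave3 ct (i + j) p := by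
      intro p
      rw [hM, ← tsum_mul_left]
      refine tsum_congr fun j => ?_
      rw [← wave3_mul]
      ring
    simp_rw [h1]
    have hnorm : ∀ j, ∫ p in box3 ct, ‖a j * basisNorm ct * wave3 ct (i + j) p‖ =
        ‖a j‖ * (basisNorm ct * ∫ p in box3 ct, (1 : ℝ)) := by
      intro j
      rw [← mul_assoc, ← integral_const_mul]
      refine integral_congr_ae (Eventually.of_forall fun p => ?_)
      simp [norm_wave3, abs_of_pos hκ]
    rw [← integral_tsum_of_summable_integral_norm
      (F := fun j p => a j * basisNorm ct * wave3 ct (i + j) p)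
      (fun j => (continuous_const.mul (continuous_wave3 ct (i + j))).continuousOn
        |>.integrableOn_compact (isCompact_box3 ct))
      (by simp_rw [hnorm]; exact hsum.mul_right _)]
    have h2 : ∀ j, ∫ p in box3 ct, a j * basisNorm ct * wave3 ct (i + j) p =
        if j = -i then a j * basisNorm ct * ((8 * π ^ 2 * ct : ℝ) : ℂ) else 0 := by
      intro j
      rw [integral_const_mul, integral_wave3 ct hct]
      by_cases h : j = -i
      · rw [if_pos h, if_pos (by rw [h, add_neg_cancel])]
      · rw [if_neg h, if_neg (fun h' => h (eq_neg_of_add_eq_zero_right h')), mul_zero]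
    simp_rw [h2]
    rw [tsum_ite_eq, mul_assoc]
  have hD : ∀ i, ∫ p in box3 ct, wave3 ct i p * (g p - M p) = 0 := by
    intro i
    simp_rw [mul_sub]
    rw [integral_sub (hwave g i hg) (hwave M i hMi), hMint, ha, neg_neg]
    have h := basisNorm_sq_mul hct
    have hcomm : ∫ p in box3 ct, g p * wave3 ct i p = ∫ p in box3 ct, wave3 ct i p * g p := by
      simp_rw [mul_comm]
    rw [hcomm]
    linear_combination (-(∫ p in box3 ct, wave3 ct i p * g p)) * h
  have hae := ae_eq_zero_of_integral_wave3_mul_eq_zero hct (hg.sub hMi) hD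
  have hopen : IsOpen {p : (ℝ × ℝ) × ℝ | p.2 ≠ 0} := isOpen_ne_fun continuous_snd continuous_const
  have hU : IsOpen (interior (box3 ct) ∩ {p | p.2 ≠ 0}) := isOpen_interior.inter hopen
  have heq : Set.EqOn g M (interior (box3 ct) ∩ {p | p.2 ≠ 0}) := by
    refine Measure.eqOn_open_of_ae_eq (μ := volume) ?_ hU (hgc.mono Set.inter_subset_right)
      hMc.continuousOn
    filter_upwards [ae_restrict_of_ae hae, ae_restrict_mem hU.measurableSet] with p hp hpU
    exact sub_eq_zero.1 (hp hpU.1)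
  refine heq.of_subset_closure (hgc.mono Set.inter_subset_right) hMc.continuousOn
    (Set.inter_subset_inter_left _ interior_subset) ?_
  nth_rewrite 1 [← closure_interior_box3 hct]
  exact hopen.closure_inter

/-- Truncated Fourier series converge at the rate at which the weighted coefficients decay. -/
theorem norm_sum_cubeIdx_sub_tsum_le {ct : ℝ} (hct : 0 < ct) {m : ℕ} {C : ℝ}
    {a : ℤ × ℤ × ℤ → ℂ} {w : ℤ × ℤ × ℤ → ℝ} (hw : Summable w) (hw0 : ∀ j, 0 ≤ w j) (hC : 0 ≤ C)
    (ha : ∀ j, ‖a j‖ ≤ C / (1 + |(j.1 : ℝ)| + |(j.2.1 : ℝ)| + |(j.2.2 : ℝ)|) ^ m * w j)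
    {N : ℕ} (hN : 0 < N) (p : (ℝ × ℝ) × ℝ) :
    ‖∑ j ∈ cubeIdx N, a j * (basisNorm ct * wave3 ct j p) -
        ∑' j, a j * (basisNorm ct * wave3 ct j p)‖ ≤
      basisNorm ct * C * (∑' j, w j) / (N : ℝ) ^ m := by
  have hκ := basisNorm_pos hct
  have hN' : (0 : ℝ) < N := by exact_mod_cast hN
  set f : ℤ × ℤ × ℤ → ℂ := fun j => a j * (basisNorm ct * wave3 ct j p) with hf
  have hterm : ∀ j, ‖f j‖ = basisNorm ct * ‖a j‖ := by
    intro j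
    rw [hf, norm_mul, norm_mul, norm_wave3, Complex.norm_real, Real.norm_of_nonneg hκ.le, mul_one,
      mul_comm]
  have hfle : ∀ j, ‖f j‖ ≤ basisNorm ct * C * w j := by
    intro j
    have h1 := one_le_index_size j
    rw [hterm, mul_assoc]
    refine mul_le_mul_of_nonneg_left ((ha j).trans ?_) hκ.le
    exact mul_le_mul_of_nonneg_right (div_le_self hC (one_le_pow₀ h1)) (hw0 j)
  have hfs : Summable fun j => ‖f j‖ :=
    Summable.of_nonneg_of_le (fun j => norm_nonneg _) hfle (hw.mul_left _)
  rw [← hfs.of_norm.sum_add_tsum_compl (s := cubeIdx N), sub_add_cancel_left, norm_neg]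
  have hs1 : Summable fun j : ↑((cubeIdx N : Set (ℤ × ℤ × ℤ))ᶜ) => ‖f j‖ := hfs.subtype _
  have hs2 : Summable fun j : ↑((cubeIdx N : Set (ℤ × ℤ × ℤ))ᶜ) => w j := hw.subtype _
  calc _ ≤ ∑' j : ↑((cubeIdx N : Set (ℤ × ℤ × ℤ))ᶜ), ‖f j‖ := norm_tsum_le_tsum_norm hs1
    _ ≤ ∑' j : ↑((cubeIdx N : Set (ℤ × ℤ × ℤ))ᶜ), basisNorm ct * C / (N : ℝ) ^ m * w j := by
      refine hs1.tsum_le_tsum (fun j => ?_) (hs2.mul_left _)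
      have hj : (j : ℤ × ℤ × ℤ) ∉ cubeIdx N := fun h => j.2 (Finset.mem_coe.2 h)
      have h2 := le_index_size_of_notMem_cubeIdx hj
      rw [hterm, mul_div_assoc, mul_assoc]
      refine mul_le_mul_of_nonneg_left ((ha j).trans ?_) hκ.le
      have := hw0 j
      gcongr
    _ = basisNorm ct * C / (N : ℝ) ^ m * ∑' j : ↑((cubeIdx N : Set (ℤ × ℤ × ℤ))ᶜ), w j :=
      tsum_mul_left
    _ ≤ basisNorm ct * C / (N : ℝ) ^ m * ∑' j, w j := by
      gcongr
      exact hw.tsum_subtype_le w _ hw0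
    _ = _ := by ring

end UniformConvergence

section CoefficientDecay

variable {k α₁ α₂ b c ct ε : ℝ} {𝒳 𝒴 : ℝ → ℝ}

theorem norm_betaCoef3_le_add_norm_freqVec (hk : 0 < k) (j : ℤ × ℤ × ℤ) :
    ‖betaCoef3 k α₁ α₂ (j.1, j.2.1)‖ ≤ k + ‖freqVec α₁ α₂ ct j‖ := by
  obtain ⟨-, -, hsq⟩ := betaCoef3_cases k α₁ α₂ hk (j.1, j.2.1)
  have hρ := norm_freqVec_sq α₁ α₂ ct j
  refine le_of_sq_le_sq ?_ (by positivity)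
  rw [← norm_pow, hsq, Complex.norm_real, Real.norm_eq_abs, abs_le]
  have := mul_nonneg hk.le (norm_nonneg (freqVec α₁ α₂ ct j))
  constructor <;>
    nlinarith [sq_nonneg (α₁ + (j.1 : ℝ)), sq_nonneg (α₂ + (j.2.1 : ℝ)),
      sq_nonneg ((j.2.2 : ℝ) * (π / ct))]

theorem abs_le_norm_freqVec (j : ℤ × ℤ × ℤ) :
    |(j.2.2 : ℝ) * (π / ct)| ≤ ‖freqVec α₁ α₂ ct j‖ := by
  refine abs_le_of_sq_le_sq ?_ (norm_nonneg _)
  rw [norm_freqVec_sq]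
  nlinarith [sq_nonneg (α₁ + (j.1 : ℝ)), sq_nonneg (α₂ + (j.2.1 : ℝ))]

theorem integrableOn_funLd (hk : 0 < k) (hb : 0 < b)
    (hβ : ∀ n : ℤ × ℤ, b ≤ ‖betaCoef3 k α₁ α₂ n‖) (h𝒳 : Continuous 𝒳)
    (h𝒳0 : ∀ t : ℝ, ct ≤ |t| → 𝒳 t = 0)
    (h𝒴 : Continuous 𝒴) (h𝒴0 : ∀ t : ℝ, 2 * ε ≤ t → 𝒴 t = 0) :
    IntegrableOn (funKd k α₁ α₂ 𝒳) (domDd ct) ∧ IntegrableOn (funF3 k α₁ α₂ 𝒴) (domDd ct) := by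
  refine ⟨?_, (integrable_funF3 h𝒴 h𝒴0).integrableOn⟩
  rw [← measurePreserving_ofProd.integrableOn_comp_preimage measurableEmbedding_ofProd,
    ofProd_preimage_domDd]
  exact integrableOn_funKd_ofProd hk hb hβ h𝒳 h𝒳0

theorem norm_fBasis3 (hct : 0 < ct) (j : ℤ × ℤ × ℤ) (x : EuclideanSpace ℝ (Fin 3)) :
    ‖fBasis3 ct j x‖ = basisNorm ct := by
  rw [← ofProd_euclideanEquivProd x, fBasis3_ofProd, norm_mul, norm_wave3, mul_one,
    Complex.norm_real]
  exact Real.norm_of_nonneg (basisNorm_pos hct).le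

theorem continuous_fBasis3 (j : ℤ × ℤ × ℤ) : Continuous (fBasis3 ct j) := by
  unfold fBasis3
  fun_prop

theorem norm_fourierCoef3_le (hct : 0 < ct) (g : EuclideanSpace ℝ (Fin 3) → ℂ) (j : ℤ × ℤ × ℤ) :
    ‖fourierCoef3 ct g j‖ ≤ (∫ x in domDd ct, ‖g x‖) * basisNorm ct := by
  rw [fourierCoef3, ← integral_mul_const]
  refine (norm_integral_le_integral_norm _).trans_eq ?_
  simp_rw [norm_mul, norm_fBasis3 hct]

theorem fourierCoef3_sub (hct : 0 < ct) {f g : EuclideanSpace ℝ (Fin 3) → ℂ}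
    (hf : IntegrableOn f (domDd ct)) (hg : IntegrableOn g (domDd ct)) (j : ℤ × ℤ × ℤ) :
    fourierCoef3 ct (fun x => f x - g x) j = fourierCoef3 ct f j - fourierCoef3 ct g j := by
  have h : ∀ f : EuclideanSpace ℝ (Fin 3) → ℂ, IntegrableOn f (domDd ct) →
      IntegrableOn (fun x => f x * fBasis3 ct (-j) x) (domDd ct) := fun f hf =>
    hf.mul_bdd (c := basisNorm ct) (continuous_fBasis3 (-j)).aestronglyMeasurable
      (Filter.Eventually.of_forall fun x => (norm_fBasis3 hct (-j) x).le)
  unfold fourierCoef3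
  rw [← integral_sub (h f hf) (h g hg)]
  simp_rw [sub_mul]

/-- The Fourier coefficients of the regular part of the Green's function decay. -/
theorem exists_norm_fourierCoef3_funLd_le (m : ℕ) (hk : 0 < k)
    (hc : 0 < c) (hcct : c < ct) (hε : 0 < ε) (hε' : ε < min 1 ct / 2)
    (hb : 0 < b) (hβ : ∀ n : ℤ × ℤ, b ≤ ‖betaCoef3 k α₁ α₂ n‖)
    (h𝒳 : ContDiff ℝ (m + 2 + 1 : ℕ) 𝒳) (h𝒳1 : ∀ t : ℝ, |t| ≤ c → 𝒳 t = 1)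
    (h𝒳0 : ∀ t : ℝ, (c + ct) / 2 ≤ |t| → 𝒳 t = 0)
    (h𝒴 : ContDiff ℝ (m + 2 + 1 : ℕ) 𝒴)
    (h𝒴1 : ∀ t : ℝ, t ≤ ε → 𝒴 t = 1) (h𝒴0 : ∀ t : ℝ, 2 * ε ≤ t → 𝒴 t = 0) :
    ∃ C : ℝ, 0 ≤ C ∧ ∀ j : ℤ × ℤ × ℤ, ‖fourierCoef3 ct (funLd k α₁ α₂ 𝒳 𝒴) j‖ ≤
      C / (1 + |(j.1 : ℝ)| + |(j.2.1 : ℝ)| + |(j.2.2 : ℝ)|) ^ m *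
        (intWeight j.1 * (intWeight j.2.1 * intWeight j.2.2)) := by
  have hct : 0 < ct := hc.trans hcct
  obtain ⟨BF, hBF0, hBF⟩ := exists_norm_fourierCoef3_funF3_sub_le (α₁ := α₁) (α₂ := α₂) (m + 2) h𝒴
    hk hct hε hε' h𝒴1 h𝒴0
  obtain ⟨BK, hBK0, hBK⟩ := exists_norm_fourierCoef3_funKd_sub_le (m + 2) h𝒳 hk hb hc hcct hβ
    h𝒳1 h𝒳0
  obtain ⟨c₀, hc₀, hβ'⟩ := exists_le_norm_betaCoef3 k α₁ α₂ hk hb hβ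
  obtain ⟨E, hE0, hE⟩ := exists_exp_neg_norm_betaCoef3_le k α₁ α₂ hc₀ hβ' hc
  have hκ := basisNorm_pos hct
  obtain ⟨hKi, hFi⟩ := integrableOn_funLd (α₁ := α₁) (α₂ := α₂) (ct := ct) hk hb hβ
    h𝒳.continuous (fun t ht => h𝒳0 t (by linarith)) h𝒴.continuous h𝒴0
  set A := (∫ x in domDd ct, ‖funLd k α₁ α₂ 𝒳 𝒴 x‖) * basisNorm ct with hA
  have hA0 : 0 ≤ A := by positivity
  set r₀ := min c₀ (π / ct) / 4 with hr₀
  have hr₀0 : 0 < r₀ := by positivity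
  set J₀ := 2 * k / r₀ with hJ₀
  have hJ₀0 : 0 < J₀ := by positivity
  refine ⟨A * J₀ ^ (m + 4) + (BK * E / r₀ ^ (m + 3) + BF / r₀ ^ (m + 4)), by positivity,
    fun j => ?_⟩
  have hw4 := inv_pow_four_le_intWeight_prod_prod j
  have hJ1 := one_le_index_size j
  have hj3 : intWeight j.2.2 ≥ ((1 + |(j.1 : ℝ)| + |(j.2.1 : ℝ)| + |(j.2.2 : ℝ)|) ^ 3)⁻¹ := by
    refine le_trans ?_ (rpow_neg_le_intWeight (l := j.2.2)
      (J := 1 + |(j.1 : ℝ)| + |(j.2.1 : ℝ)| + |(j.2.2 : ℝ)|)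
      (by linarith [abs_nonneg (j.1 : ℝ), abs_nonneg (j.2.1 : ℝ)]))
    rw [← Real.rpow_natCast, ← Real.rpow_neg (by linarith)]
    exact Real.rpow_le_rpow_of_exponent_le hJ1 (by norm_num)
  have hgrow : 2 * (r₀ * (1 + |(j.1 : ℝ)| + |(j.2.1 : ℝ)| + |(j.2.2 : ℝ)|)) ≤
      (‖betaCoef3 k α₁ α₂ (j.1, j.2.1)‖ + |(j.2.2 : ℝ) * (π / ct)|) / 2 := by
    have h1 := hβ' (j.1, j.2.1)
    have h2 : min c₀ (π / ct) ≤ c₀ := min_le_left _ _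
    have h3 : min c₀ (π / ct) ≤ π / ct := min_le_right _ _
    rw [abs_mul, abs_of_pos (a := π / ct) (by positivity)]
    have h4 : min c₀ (π / ct) * (1 + |(j.1 : ℝ)| + |(j.2.1 : ℝ)|) ≤
        c₀ * (1 + |(j.1 : ℝ)| + |(j.2.1 : ℝ)|) := by gcongr
    have h5 : min c₀ (π / ct) * |(j.2.2 : ℝ)| ≤ π / ct * |(j.2.2 : ℝ)| := by gcongr
    dsimp only at h1
    rw [hr₀]
    linarith
  set J := 1 + |(j.1 : ℝ)| + |(j.2.1 : ℝ)| + |(j.2.2 : ℝ)| with hJ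
  have hJ0 : 0 < J := by linarith
  have w1 := intWeight_nonneg j.1
  have w2 := intWeight_nonneg j.2.1
  have w3 := intWeight_nonneg j.2.2
  set w := intWeight j.1 * (intWeight j.2.1 * intWeight j.2.2) with hw
  have hw0 : 0 ≤ w := by positivity
  have hJm : ∀ D : ℝ, 0 ≤ D → D / J ^ (m + 4) ≤ D / J ^ m * w := by
    intro D hD
    calc D / J ^ (m + 4) = D / J ^ m * (J ^ 4)⁻¹ := by
          rw [pow_add]
          field_simp
      _ ≤ _ := by gcongr
  rcases lt_or_ge J J₀ with hsmall | hlarge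
  · calc ‖fourierCoef3 ct (funLd k α₁ α₂ 𝒳 𝒴) j‖ ≤ A := norm_fourierCoef3_le hct _ j
      _ ≤ A * J₀ ^ (m + 4) / J ^ (m + 4) := by
          rw [mul_div_assoc, ← div_pow]
          exact le_mul_of_one_le_right hA0 (one_le_pow₀ ((one_le_div hJ0).2 hsmall.le))
      _ ≤ A * J₀ ^ (m + 4) / J ^ m * w := hJm _ (by positivity)
      _ ≤ _ := by
          gcongr
          exact le_add_of_nonneg_right (by positivity)
  · have hrJ : 2 * k ≤ r₀ * J := by
      have := (div_le_iff₀ hr₀0).1 hlarge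
      linarith
    set r := r₀ * J with hr
    have hr0 : 0 < r := by positivity
    have hp := le_norm_betaCoef3_add k α₁ α₂ hk (j.1, j.2.1) ((j.2.2 : ℝ) * (π / ct))
    have hn := le_norm_betaCoef3_add k α₁ α₂ hk (j.1, j.2.1) (-((j.2.2 : ℝ) * (π / ct)))
    rw [abs_neg, ofReal_neg, ← sub_eq_add_neg] at hn
    have hρ1 := norm_betaCoef3_le_add_norm_freqVec (α₁ := α₁) (α₂ := α₂) (ct := ct) hk j
    have hρ2 := abs_le_norm_freqVec (α₁ := α₁) (α₂ := α₂) (ct := ct) j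
    have hρr : r ≤ ‖freqVec α₁ α₂ ct j‖ - k := by linarith
    have hK := hBK j r hr0 (by linarith) (by linarith)
    have hF := hBF j (by linarith)
    have hsplit : fourierCoef3 ct (funLd k α₁ α₂ 𝒳 𝒴) j =
        (fourierCoef3 ct (funKd k α₁ α₂ 𝒳) j -
          basisNorm ct / ((‖freqVec α₁ α₂ ct j‖ ^ 2 - k ^ 2 : ℝ) : ℂ)) -
        (fourierCoef3 ct (funF3 k α₁ α₂ 𝒴) j -
          basisNorm ct / ((‖freqVec α₁ α₂ ct j‖ ^ 2 - k ^ 2 : ℝ) : ℂ)) := by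
      rw [sub_sub_sub_cancel_right, ← fourierCoef3_sub hct hKi hFi]
      rfl
    have hK' : BK * Real.exp (-c * ‖betaCoef3 k α₁ α₂ (j.1, j.2.1)‖) / r ^ (m + 2 + 1) ≤
        BK * E / r₀ ^ (m + 3) / J ^ m * w := by
      calc _ ≤ BK * (E * (intWeight j.1 * intWeight j.2.1)) / r ^ (m + 3) := by
            gcongr
            exact hE (j.1, j.2.1)
        _ = BK * E / r₀ ^ (m + 3) / J ^ m * (intWeight j.1 * intWeight j.2.1 * (J ^ 3)⁻¹) := by
            rw [hr, mul_pow, pow_add J]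
            field_simp
        _ ≤ BK * E / r₀ ^ (m + 3) / J ^ m * (intWeight j.1 * intWeight j.2.1 * intWeight j.2.2) := by
            gcongr
        _ = _ := by rw [hw]; ring
    have hF' : BF / (‖freqVec α₁ α₂ ct j‖ * (‖freqVec α₁ α₂ ct j‖ - k) ^ (m + 2 + 1)) ≤
        BF / r₀ ^ (m + 4) / J ^ m * w := by
      calc _ ≤ BF / (r * r ^ (m + 3)) := by
            gcongr
            linarith
        _ = BF / r₀ ^ (m + 4) / J ^ (m + 4) := by
            rw [← pow_succ', hr, mul_pow]
            field_simp
        _ ≤ _ := hJm _ (by positivity)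
    rw [hsplit]
    refine (norm_sub_le _ _).trans ?_
    calc _ ≤ BK * E / r₀ ^ (m + 3) / J ^ m * w + BF / r₀ ^ (m + 4) / J ^ m * w :=
          add_le_add (hK.trans hK') (hF.trans hF')
      _ = (BK * E / r₀ ^ (m + 3) + BF / r₀ ^ (m + 4)) / J ^ m * w := by ring
      _ ≤ (A * J₀ ^ (m + 4) + (BK * E / r₀ ^ (m + 3) + BF / r₀ ^ (m + 4))) / J ^ m * w := by
          refine mul_le_mul_of_nonneg_right (div_le_div_of_nonneg_right ?_ (by positivity)) hw0
          exact le_add_of_nonneg_left (by positivity)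

theorem continuousOn_funLd_ofProd (hk : 0 < k) (hb : 0 < b)
    (hβ : ∀ n : ℤ × ℤ, b ≤ ‖betaCoef3 k α₁ α₂ n‖) (h𝒳 : Continuous 𝒳)
    (h𝒳0 : ∀ t : ℝ, ct ≤ |t| → 𝒳 t = 0) (h𝒴 : Continuous 𝒴) :
    ContinuousOn (fun p => funLd k α₁ α₂ 𝒳 𝒴 (ofProd p)) {p | p.2 ≠ 0} := by
  refine (continuousOn_funKd_ofProd hk hb hβ h𝒳 h𝒳0).sub
    ((continuousOn_funF3 h𝒴).comp continuous_ofProd.continuousOn fun p hp h => hp ?_)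
  have : (ofProd p) 2 = (0 : EuclideanSpace ℝ (Fin 3)) 2 := by rw [h]
  exact this

end CoefficientDecay

/-- Theorem 5.3: if 𝒳, 𝒴_ε ∈ C^{m+3}, then L_{dN} converges uniformly to L_d with m-th
order accuracy: ‖L_{dN} − L_d‖_{L^∞} ≤ C N^{−m}. -/
theorem statement16 (m : ℕ) (hm : 0 < m) (k α₁ α₂ c ct ε : ℝ) (hk : 0 < k)
    (hc : 0 < c) (hcct : c < ct) (hε : 0 < ε) (hε' : ε < min 1 ct / 2)
    (b : ℝ) (hb : 0 < b) (hβ : ∀ n : ℤ × ℤ, b ≤ ‖betaCoef3 k α₁ α₂ n‖)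
    (𝒳 : ℝ → ℝ) (h𝒳 : ContDiff ℝ (m + 3) 𝒳)
    (h𝒳1 : ∀ t : ℝ, |t| ≤ c → 𝒳 t = 1)
    (h𝒳0 : ∀ t : ℝ, (c + ct) / 2 ≤ |t| → 𝒳 t = 0)
    (𝒴 : ℝ → ℝ) (h𝒴 : ContDiff ℝ (m + 3) 𝒴)
    (h𝒴1 : ∀ t : ℝ, t ≤ ε → 𝒴 t = 1)
    (h𝒴0 : ∀ t : ℝ, 2 * ε ≤ t → 𝒴 t = 0) :
    ∃ C > (0 : ℝ), ∀ N : ℕ, 0 < N →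
      ∀ x : EuclideanSpace ℝ (Fin 3), x ∈ domDd ct → x 2 ≠ 0 →
        ‖funLdN k α₁ α₂ ct 𝒳 𝒴 N x - funLd k α₁ α₂ 𝒳 𝒴 x‖ ≤ C / (N : ℝ) ^ m := by
  have hct : 0 < ct := hc.trans hcct
  have hκ := basisNorm_pos hct
  have h𝒳' : ContDiff ℝ (m + 2 + 1 : ℕ) 𝒳 := by exact_mod_cast h𝒳
  have h𝒴' : ContDiff ℝ (m + 2 + 1 : ℕ) 𝒴 := by exact_mod_cast h𝒴
  have h𝒳0' : ∀ t : ℝ, ct ≤ |t| → 𝒳 t = 0 := fun t ht => h𝒳0 t (by linarith)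
  obtain ⟨C, hC, hdecay⟩ := exists_norm_fourierCoef3_funLd_le m hk hc hcct hε hε' hb hβ h𝒳' h𝒳1
    h𝒳0 h𝒴' h𝒴1 h𝒴0
  have hw0 : ∀ j : ℤ × ℤ × ℤ, 0 ≤ intWeight j.1 * (intWeight j.2.1 * intWeight j.2.2) := fun j =>
    mul_nonneg (intWeight_nonneg _) (mul_nonneg (intWeight_nonneg _) (intWeight_nonneg _))
  have hW := summable_intWeight_prod_prod
  obtain ⟨hKi, hFi⟩ := integrableOn_funLd (α₁ := α₁) (α₂ := α₂) hk hb hβ h𝒳.continuous h𝒳0'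
    h𝒴.continuous h𝒴0
  have hLi : IntegrableOn (fun p => funLd k α₁ α₂ 𝒳 𝒴 (ofProd p)) (box3 ct) := by
    have h := (measurePreserving_ofProd.integrableOn_comp_preimage measurableEmbedding_ofProd).2
      (hKi.sub hFi)
    rwa [ofProd_preimage_domDd] at h
  have hcoef : ∀ j, fourierCoef3 ct (funLd k α₁ α₂ 𝒳 𝒴) j =
      basisNorm ct * ∫ p in box3 ct, funLd k α₁ α₂ 𝒳 𝒴 (ofProd p) * wave3 ct (-j) p := by
    intro j
    rw [fourierCoef3, setIntegral_domDd, ← integral_const_mul]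
    simp_rw [fBasis3_ofProd]
    refine integral_congr_ae (Filter.Eventually.of_forall fun p => ?_)
    dsimp only
    rw [basisNorm]
    ring
  have hsum : Summable fun j => ‖fourierCoef3 ct (funLd k α₁ α₂ 𝒳 𝒴) j‖ :=
    Summable.of_nonneg_of_le (fun j => norm_nonneg _) (fun j => (hdecay j).trans
      (mul_le_mul_of_nonneg_right (div_le_self hC (one_le_pow₀ (one_le_index_size j))) (hw0 j)))
      (hW.mul_left C)
  have heq := eqOn_tsum_wave3 hct hLi
    (continuousOn_funLd_ofProd hk hb hβ h𝒳.continuous h𝒳0' h𝒴.continuous) hcoef hsum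
  refine ⟨basisNorm ct * C * (∑' j : ℤ × ℤ × ℤ,
    intWeight j.1 * (intWeight j.2.1 * intWeight j.2.2)) + 1, ?_, fun N hN x hx hx2 => ?_⟩
  · have : 0 ≤ ∑' j : ℤ × ℤ × ℤ, intWeight j.1 * (intWeight j.2.1 * intWeight j.2.2) :=
      tsum_nonneg hw0
    positivity
  obtain ⟨p, rfl⟩ : ∃ p, ofProd p = x := ⟨_, ofProd_euclideanEquivProd x⟩
  have hp : p ∈ box3 ct ∩ {p | p.2 ≠ 0} := ⟨by rwa [← ofProd_preimage_domDd], hx2⟩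
  have h1 := heq hp
  dsimp only at h1
  have h2 := norm_sum_cubeIdx_sub_tsum_le hct hW hw0 hC hdecay hN p
  rw [← h1] at h2
  have h3 : funLdN k α₁ α₂ ct 𝒳 𝒴 N (ofProd p) = ∑ j ∈ cubeIdx N,
      fourierCoef3 ct (funLd k α₁ α₂ 𝒳 𝒴) j * (basisNorm ct * wave3 ct j p) := by
    rw [funLdN]
    simp_rw [fBasis3_ofProd]
    rfl
  rw [h3]
  refine h2.trans ?_
  gcongr
  linarith

end
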